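/- arXiv:2603.08454 — 6 statements merged into one kernel-verified Lean document; each statement's English description precedes it below -/
import Mathlib

section
/- Let G be a graph (possibly with parallel edges), let δ be an infinite cardinal, let p be a natural number, and let a, b be two vertices of G such that G contains a family of δ pairwise edge-disjoint a–b paths, each of length at most p. Then G contains a family of δ pairwise edge-disjoint a–b paths that are pairwise order-compatible. -/
universe u

/-- A multigraph: possibly parallel edges, no loops. Each edge `e` has a pair of
distinct endpoints `ends e`. -/
structure Multigraph (V : Type u) (E : Type u) : Type u where
  ends : E → Sym2 V
  not_loop : ∀ e, ¬ (ends e).IsDiag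

namespace Multigraph

variable {V E : Type u}

/-- A path from `a` to `b` in a multigraph, given by its (duplicate-free) list of
vertices, traversed from `a` to `b`, together with the list of edges it uses. -/
structure Path (G : Multigraph V E) (a b : V) : Type u where
  verts : List V
  edges : List E
  nodup : verts.Nodup
  length_eq : verts.length = edges.length + 1
  head_eq : verts.head? = some a
  last_eq : verts.getLast? = some b
  inc : ∀ i, ∀ h : i + 1 < verts.length,
    G.ends (edges[i]'(by omega)) = s(verts[i]'(by omega), verts[i + 1]'h)

variable {G : Multigraph V E}

/-- The length of a path is its number of edges. -/
def Path.length {a b : V} (P : G.Path a b) : ℕ := P.edges.length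

/-- Two paths are edge-disjoint if they share no edge. -/
def EdgeDisjoint {a b a' b' : V} (P : G.Path a b) (Q : G.Path a' b') : Prop :=
  ∀ e, e ∈ P.edges → e ∉ Q.edges

/-- Two (oriented) paths are order-compatible if their common vertices occur in the
same order along both. -/
def OrderCompatible {a b a' b' : V} (P : G.Path a b) (Q : G.Path a' b') : Prop :=
  ∀ u v : V, u ∈ P.verts → v ∈ P.verts → u ∈ Q.verts → v ∈ Q.verts →
    ([u, v].Sublist P.verts ↔ [u, v].Sublist Q.verts)

/-- Two `a`–`b` paths are internally disjoint if they meet only in `a` and `b`. -/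
def InternallyDisjoint {a b : V} (P Q : G.Path a b) : Prop :=
  ∀ x, x ∈ P.verts → x ∈ Q.verts → x = a ∨ x = b

/-- `κ_V(a,b) ≥ δ`: there are `δ` pairwise internally vertex-disjoint `a`–`b` paths. -/
def KappaVGe (G : Multigraph V E) (a b : V) (δ : Cardinal.{u}) : Prop :=
  ∃ S : Set (G.Path a b), S.Pairwise InternallyDisjoint ∧ δ ≤ Cardinal.mk S

end Multigraph

universe v

section

open Cardinal Set

theorem exists_large_pairwise {ι : Type u} {δ : Cardinal.{u}} {R : ι → ι → Prop} [Std.Symm R]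
    (h : ∀ T : Set ι, #T < δ → ∃ i ∉ T, ∀ j ∈ T, R i j) :
    ∃ T : Set ι, δ ≤ #T ∧ T.Pairwise R := by
  obtain ⟨T, hT⟩ := zorn_subset {T : Set ι | T.Pairwise R} fun c hc hchain =>
    ⟨⋃₀ c, (pairwise_sUnion hchain.directedOn).2 hc, fun s hs => subset_sUnion_of_mem hs⟩
  refine ⟨T, ?_, hT.prop⟩
  by_contra! hlt
  obtain ⟨i, hi, hij⟩ := h T hlt
  have hins : (insert i T).Pairwise R :=
    pairwise_insert_of_symm.2 ⟨hT.prop, fun j hj _ => hij j hj⟩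
  exact hi (hT.le_of_ge hins (subset_insert i T) (mem_insert i T))

theorem exists_lt_mk_fiber {S T : Type u} (f : S → T) (hS : ℵ₀ < #S) (hT : #T < #S)
    {ν : Cardinal.{u}} (hν : ν < #S) : ∃ s, ν < #{s' | f s' = f s} := by
  set μ := max (max #T ν) ℵ₀
  have hμS : μ < #S := max_lt (max_lt hT hν) hS
  have hμ₀ : ℵ₀ ≤ μ := le_max_right _ _
  obtain ⟨t, ht⟩ := infinite_pigeonhole_card f (Order.succ μ) (Order.succ_le_of_lt hμS)
    (hμ₀.trans (Order.le_succ μ)) (by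
      rw [(isRegular_succ hμ₀).cof_ord]
      exact Order.lt_succ_of_le ((le_max_left _ _).trans (le_max_left _ _)))
  have hνt : ν < #(f ⁻¹' {t}) :=
    (Order.lt_succ_of_le ((le_max_right _ _).trans (le_max_left _ _))).trans_le ht
  obtain ⟨⟨s, rfl⟩⟩ := mk_ne_zero_iff.1 (ne_zero_of_lt hνt)
  exact ⟨s, hνt⟩

/-- Few fibres of a function on a large set are already cofinal in size. -/
theorem exists_few_fibers {S T : Type u} (f : S → T) (hS : ℵ₀ ≤ #S) (hT : #T < #S) :
    ∃ (Λ : Type u) (c : Λ → S), #Λ < #S ∧ (ℵ₀ ≤ #Λ ∨ Subsingleton Λ) ∧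
      ∀ L : Set Λ, #Λ ≤ #L → #S ≤ #{s | ∃ j ∈ L, f s = f (c j)} := by
  have hcof : ℵ₀ ≤ (#S).ord.cof :=
    Ordinal.aleph0_le_cof_iff.2 (Ordinal.one_lt_cof_iff.2 (isSuccLimit_ord hS))
  rcases (Ordinal.cof_ord_le #S).eq_or_lt with hreg | hsing
  · obtain ⟨t, ht⟩ := infinite_pigeonhole_card f #S le_rfl hS (hT.trans_eq hreg.symm)
    obtain ⟨⟨s, rfl⟩⟩ := mk_ne_zero_iff.1
      (ne_zero_of_lt ((aleph0_pos.trans_le hS).trans_le ht))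
    refine ⟨PUnit, fun _ => s, ?_, Or.inr inferInstance, fun L hL => ?_⟩
    · simpa using one_lt_aleph0.trans_le hS
    · obtain ⟨⟨j, hj⟩⟩ := mk_ne_zero_iff.1 (ne_zero_of_lt ((by simp : 0 < #PUnit).trans_le hL))
      exact ht.trans (mk_le_mk_of_subset fun s' hs' => ⟨j, hj, hs'⟩)
  · obtain ⟨s, hs, hsord⟩ := Ordinal.exists_ord_cof_eq (#S).ord.ToType
    rw [Ordinal.cof_toType] at hsord
    have hcard : #s = (#S).ord.cof := by
      rw [← card_ord (#S).ord.cof, ← hsord, Ordinal.card_type]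
    have hfib (j : s) : ∃ c, #(Iio j.1) < #{s' | f s' = f c} :=
      exists_lt_mk_fiber f (hcof.trans_lt hsing) hT ((mk_Iio_lt j.1 (by simp)).trans_eq (by simp))
    choose c hc using hfib
    refine ⟨s, c, hcard ▸ hsing, Or.inl (hcard ▸ hcof), fun L hL => ?_⟩
    by_contra! hlt
    set μ := #{s' | ∃ j ∈ L, f s' = f (c j)}
    obtain ⟨w, hw⟩ := Ordinal.typein_surj (α := (#S).ord.ToType) (· < ·)
      (o := μ.ord) (by simpa using hlt)
    have hwμ : #(Iio w) = μ := by
      have := congrArg Ordinal.card hw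
      rwa [card_ord] at this
    obtain ⟨y, hy, hwy⟩ := hs w
    obtain ⟨j, hjL, hj⟩ : ∃ j ∈ L, (⟨y, hy⟩ : s) ≤ j := by
      by_contra! hcon
      have h1 : #L ≤ #(Iio (⟨y, hy⟩ : s)) := mk_le_mk_of_subset fun j hj => hcon j hj
      exact (hL.trans h1).not_gt (mk_Iio_lt _ (by rw [hcard]; exact hsord.symm))
    have h2 : μ ≤ #(Iio j.1) := hwμ ▸ mk_le_mk_of_subset (Iio_subset_Iio (hwy.trans hj))
    have h3 : #{s' | f s' = f (c j)} ≤ μ := mk_le_mk_of_subset fun s' hs' => ⟨j, hjL, hs'⟩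
    exact (h2.trans_lt (hc j)).not_ge h3

theorem mk_iUnion_finite_lt {α : Type u} {K : Type v} [Finite K] {δ : Cardinal.{u}} (hδ : ℵ₀ ≤ δ)
    (B : K → Set α) (hB : ∀ k, #(B k) < δ) : #(⋃ k, B k) < δ := by
  have h (s : Set K) : #(⋃ k ∈ s, B k) < δ := by
    induction s, s.toFinite using Set.Finite.induction_on with
    | empty => simpa using aleph0_pos.trans_le hδ
    | @insert k s _ _ ih =>
      rw [biUnion_insert]
      exact (mk_union_le _ _).trans_lt (add_lt_of_lt hδ (hB k) ih)
  simpa using h univ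

theorem mk_arrow_finite_lt {X : Type u} {K : Type} [Finite K] {δ : Cardinal.{u}} (hδ : ℵ₀ ≤ δ)
    (hX : #X < δ) : #(K → X) < δ := by
  have h : #(K → X) = #X ^ Nat.card K := by
    have := Fintype.ofFinite K
    simp
  rw [h]
  rcases lt_or_ge #X ℵ₀ with hfin | hinf
  · exact (power_lt_aleph0 hfin natCast_lt_aleph0).trans_le hδ
  · exact (power_nat_le hinf).trans_lt hX

/-- An infinite family of injective `K`-tuples, `K` finite, has an equally large subfamily in
which every entry occurs at only one position. -/
theorem exists_large_aligned {V : Type u} (δ : Cardinal.{u}) (hδ : ℵ₀ ≤ δ) :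
    ∀ (ι : Type u) (K : Type) [Finite K] (x : ι → K → V), (∀ i, (x i).Injective) → #ι = δ →
      ∃ S : Set ι, δ ≤ #S ∧ ∀ i ∈ S, ∀ j ∈ S, ∀ k l, x i k = x j l → k = l := by
  induction δ using WellFoundedLT.induction with
  | ind δ IH =>
  intro ι K _ x hx hι
  obtain ⟨I, ⟨S, X, hS, hX, hSX⟩, hmax⟩ := (toFinite {I : Set K | ∃ (S : Set ι) (X : Set V),
    δ ≤ #S ∧ #X < δ ∧ ∀ i ∈ S, ∀ k ∈ I, x i k ∈ X}).exists_maximal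
      ⟨∅, univ, ∅, by simp [hι], by simpa using aleph0_pos.trans_le hδ, by simp⟩
  have hout (B : Set V) (hB : #B < δ) : #{i : S | ∃ k ∉ I, x i k ∈ B} < δ := by
    have hk (k : ↥Iᶜ) : #{i : S | x i k ∈ B} < δ := by
      by_contra! hlarge
      refine k.2 (hmax ⟨Subtype.val '' {i : S | x i k ∈ B}, X ∪ B, ?_, ?_, ?_⟩
        (subset_insert k.1 I) (mem_insert k.1 I))
      · rwa [mk_image_eq Subtype.val_injective]
      · exact (mk_union_le _ _).trans_lt (add_lt_of_lt hδ hX hB)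
      · rintro _ ⟨i, hi, rfl⟩ l (rfl | hl)
        · exact Or.inr hi
        · exact Or.inl (hSX i i.2 l hl)
    refine (mk_le_mk_of_subset ?_).trans_lt (mk_iUnion_finite_lt hδ _ hk)
    rintro i ⟨k, hkI, hik⟩
    exact mem_iUnion.2 ⟨⟨k, hkI⟩, hik⟩
  have hSδ : #S = δ := hS.antisymm' (hι ▸ mk_set_le S)
  obtain ⟨Λ, c, hΛ, hΛ', hL⟩ := exists_few_fibers
    (fun (i : S) (k : I) => (⟨x i k, hSX i i.2 k k.2⟩ : X)) (hSδ ▸ hδ)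
    (hSδ ▸ mk_arrow_finite_lt hδ hX)
  obtain ⟨L, hLΛ, hLx⟩ : ∃ L : Set Λ, #Λ ≤ #L ∧
      ∀ i ∈ L, ∀ j ∈ L, ∀ k l : I, x (c i) k = x (c j) l → k = l := by
    rcases hΛ' with hinf | hsub
    · exact IH _ (hSδ ▸ hΛ) hinf Λ I (fun j k => x (c j) k)
        (fun j => (hx _).comp Subtype.val_injective) rfl
    · refine ⟨univ, by simp, fun i _ j _ k l hkl => ?_⟩
      rw [Subsingleton.elim i j] at hkl
      exact Subtype.ext (hx _ hkl)
  set S' : Set S := {i | ∃ j ∈ L, (fun (k : I) => (⟨x i k, hSX i i.2 k k.2⟩ : X)) =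
    fun (k : I) => (⟨x (c j) k, hSX (c j) (c j).2 k k.2⟩ : X)}
  have hS'δ : δ ≤ #S' := hSδ ▸ hL L hLΛ
  have hS'x (i : S) (hi : i ∈ S') : ∃ j ∈ L, ∀ k ∈ I, x i k = x (c j) k := by
    obtain ⟨j, hj, hij⟩ := hi
    exact ⟨j, hj, fun k hk => congrArg Subtype.val (congrFun hij ⟨k, hk⟩)⟩
  set S'' : Set S := S' \ {i : S | ∃ k ∉ I, x i k ∈ X}
  have : Std.Symm fun i j : S'' => ∀ k ∉ I, ∀ l ∉ I, x i.1 k ≠ x j.1 l :=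
    ⟨fun i j h k hk l hl => (h l hl k hk).symm⟩
  obtain ⟨T, hT, hTR⟩ := exists_large_pairwise (ι := S'') (δ := δ)
    (R := fun i j => ∀ k ∉ I, ∀ l ∉ I, x i.1 k ≠ x j.1 l) (by
      intro T hT
      set B : Set V := ⋃ k, (fun j : S'' => x j.1 k) '' T
      have hBδ : #B < δ := mk_iUnion_finite_lt hδ _ fun k => mk_image_le.trans_lt hT
      let bad : Set S := {i : S | ∃ k ∉ I, x i k ∈ X} ∪
        ({i : S | ∃ k ∉ I, x i k ∈ B} ∪ Subtype.val '' T)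
      have hbad : #bad < δ :=
        (mk_union_le _ _).trans_lt (add_lt_of_lt hδ (hout X hX)
          ((mk_union_le _ _).trans_lt (add_lt_of_lt hδ (hout B hBδ) (mk_image_le.trans_lt hT))))
      obtain ⟨i, hi, hibad⟩ : ∃ i ∈ S', i ∉ bad := by
        by_contra! hcon
        exact (hS'δ.trans (mk_le_mk_of_subset hcon)).not_gt hbad
      refine ⟨⟨i, hi, fun h => hibad (Or.inl h)⟩,
        fun h => hibad (Or.inr (Or.inr ⟨_, h, rfl⟩)), fun j hj k hk l hl hkl => ?_⟩
      exact hibad (Or.inr (Or.inl ⟨k, hk, mem_iUnion.2 ⟨l, j, hj, hkl.symm⟩⟩)))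
  refine ⟨(Subtype.val ∘ Subtype.val : S'' → ι) '' T, ?_, ?_⟩
  · rwa [mk_image_eq (Subtype.val_injective.comp Subtype.val_injective)]
  rintro _ ⟨i, hi, rfl⟩ _ ⟨j, hj, rfl⟩ k l hkl
  simp only [Function.comp_apply] at hkl ⊢
  by_cases hk : k ∈ I <;> by_cases hl : l ∈ I
  · obtain ⟨i', hi', hii'⟩ := hS'x i i.2.1
    obtain ⟨j', hj', hjj'⟩ := hS'x j j.2.1
    rw [hii' k hk, hjj' l hl] at hkl
    exact congrArg Subtype.val (hLx i' hi' j' hj' ⟨k, hk⟩ ⟨l, hl⟩ hkl)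
  · exact (j.2.2 ⟨l, hl, hkl ▸ hSX i i.1.2 k hk⟩).elim
  · exact (i.2.2 ⟨k, hk, hkl ▸ hSX j j.1.2 l hl⟩).elim
  · by_cases hij : i = j
    · subst hij
      exact hx _ hkl
    · exact (hTR hi hj hij k hk l hl hkl).elim

theorem List.pair_sublist_iff {α : Type u} {l : List α} {u v : α} :
    [u, v].Sublist l ↔ ∃ i j : ℕ, i < j ∧ l[i]? = some u ∧ l[j]? = some v := by
  induction l with
  | nil => simp
  | cons w l ih =>
    rw [List.sublist_cons_iff, ih]
    constructor
    · rintro (⟨i, j, hij, hi, hj⟩ | ⟨r, hr, hrl⟩)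
      · exact ⟨i + 1, j + 1, by omega, by simpa using hi, by simpa using hj⟩
      · obtain ⟨rfl, rfl⟩ := List.cons_eq_cons.1 hr
        obtain ⟨j, hj⟩ := List.mem_iff_getElem?.1 (List.singleton_sublist.1 hrl)
        exact ⟨0, j + 1, by omega, by simp, by simpa using hj⟩
    · rintro ⟨i, j, hij, hi, hj⟩
      obtain ⟨j, rfl⟩ : ∃ j', j = j' + 1 := ⟨j - 1, by omega⟩
      rcases i with _ | i
      · right
        refine ⟨[v], ?_, List.singleton_sublist.2 (List.mem_iff_getElem?.2 ⟨j, by simpa using hj⟩)⟩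
        simp_all
      · left
        exact ⟨i, j, by omega, by simpa using hi, by simpa using hj⟩

theorem List.pair_sublist_of_aligned {α : Type u} {l l' : List α} {u v : α}
    (h : ∀ (i j : ℕ) (w : α), l[i]? = some w → l'[j]? = some w → i = j)
    (hu : u ∈ l') (hv : v ∈ l') (huv : [u, v].Sublist l) : [u, v].Sublist l' := by
  obtain ⟨i, j, hij, hi, hj⟩ := List.pair_sublist_iff.1 huv
  obtain ⟨i', hi'⟩ := List.mem_iff_getElem?.1 hu
  obtain ⟨j', hj'⟩ := List.mem_iff_getElem?.1 hv
  exact List.pair_sublist_iff.2 ⟨i', j', h i i' u hi hi' ▸ h j j' v hj hj' ▸ hij, hi', hj'⟩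

namespace Multigraph

variable {V E : Type u} {G : Multigraph V E}

theorem orderCompatible_of_aligned {a b a' b' : V} {P : G.Path a b} {Q : G.Path a' b'}
    (h : ∀ (i j : ℕ) (w : V), P.verts[i]? = some w → Q.verts[j]? = some w → i = j) :
    OrderCompatible P Q := fun _ _ huP hvP huQ hvQ =>
  ⟨List.pair_sublist_of_aligned h huQ hvQ,
    List.pair_sublist_of_aligned (fun i j w hi hj => (h j i w hj hi).symm) huP hvP⟩

/-- Among infinitely many paths of bounded length, equally many are pairwise order-compatible. -/
theorem exists_large_orderCompatible {a b : V} {ι : Type u} (hι : ℵ₀ ≤ #ι) (P : ι → G.Path a b)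
    (p : ℕ) (hlen : ∀ i, (P i).length ≤ p) :
    ∃ S : Set ι, #S = #ι ∧ ∀ i ∈ S, ∀ j ∈ S, OrderCompatible (P i) (P j) := by
  obtain ⟨⟨n⟩, hn⟩ := infinite_pigeonhole_card
    (fun i => (⟨⟨(P i).length, Nat.lt_succ_of_le (hlen i)⟩⟩ : ULift.{u} (Fin (p + 1)))) #ι le_rfl hι
    ((lt_aleph0_of_finite _).trans_le
      (Ordinal.aleph0_le_cof_iff.2 (Ordinal.one_lt_cof_iff.2 (isSuccLimit_ord hι))))
  set F := (fun i => (⟨⟨(P i).length, Nat.lt_succ_of_le (hlen i)⟩⟩ : ULift.{u} (Fin (p + 1)))) ⁻¹'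
    {⟨n⟩}
  have hF (i : F) : (P i).verts.length = n + 1 := by
    have h : (P i).length = n := congrArg (fun m : ULift (Fin (p + 1)) => (m.down : ℕ)) i.2
    rw [(P i).length_eq, ← h, Path.length]
  obtain ⟨S, hS, hSx⟩ := exists_large_aligned #F (hι.trans hn) F (Fin (n + 1))
    (fun i k => (P i).verts[k]'(by rw [hF i]; exact k.2))
    (fun i k l hkl => Fin.ext ((P i).nodup.getElem_inj_iff.1 hkl)) rfl
  refine ⟨Subtype.val '' S, ?_, ?_⟩
  · rw [mk_image_eq Subtype.val_injective]
    exact ((mk_set_le S).trans (mk_set_le F)).antisymm (hn.trans hS)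
  · rintro _ ⟨i, hi, rfl⟩ _ ⟨j, hj, rfl⟩
    refine orderCompatible_of_aligned fun k l w hk hl => ?_
    obtain ⟨hkP, rfl⟩ := List.getElem?_eq_some_iff.1 hk
    obtain ⟨hlP, hkl⟩ := List.getElem?_eq_some_iff.1 hl
    exact congrArg Fin.val (hSx i hi j hj ⟨k, hF i ▸ hkP⟩ ⟨l, hF j ▸ hlP⟩ hkl.symm)

end Multigraph

end

/-- **Zelinka's conjecture / Theorem 1.**  If `a` and `b` are joined by a family of
`δ` pairwise edge-disjoint paths, each of length at most `p` (with `δ` infinite),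
then they are joined by `δ` pairwise edge-disjoint, pairwise order-compatible paths. -/
theorem dirac_bounded_length {V E : Type u} (G : Multigraph V E)
    (δ : Cardinal.{u}) (hδ : Cardinal.aleph0 ≤ δ) (p : ℕ) (a b : V)
    (ι : Type u) (P : ι → G.Path a b) (hcard : Cardinal.mk ι = δ)
    (hdisj : Pairwise fun i j => Multigraph.EdgeDisjoint (P i) (P j))
    (hlen : ∀ i, (P i).length ≤ p) :
    ∃ (κ : Type u) (Q : κ → G.Path a b), Cardinal.mk κ = δ ∧
      (Pairwise fun i j => Multigraph.EdgeDisjoint (Q i) (Q j)) ∧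
      (Pairwise fun i j => Multigraph.OrderCompatible (Q i) (Q j)) := by
  subst hcard
  obtain ⟨S, hS, hcomp⟩ := Multigraph.exists_large_orderCompatible hδ P p hlen
  exact ⟨S, fun i => P i, hS, fun i j hij => hdisj (Subtype.coe_ne_coe.2 hij),
    fun i j _ => hcomp i i.2 j j.2⟩
end

section
/- Let G be a graph (possibly with parallel edges), let δ be an infinite cardinal of uncountable cofinality, and let a, b be two vertices of G such that G contains a family of δ pairwise edge-disjoint a–b paths. Then G contains a family of δ pairwise edge-disjoint a–b paths that are pairwise order-compatible. -/
universe u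

namespace Cardinal

open Order

/-- Either a large subfamily of pairs `(f i, g i)` has no value shared between its first and its
second coordinates, or many of the pairs live on a small set of values. -/
theorem exists_separated_or_concentrated {ι V : Type u} (f g : ι → V) (hfg : ∀ i, f i ≠ g i)
    (hι : ℵ₀ ≤ #ι) :
    (∃ S : Set ι, #S = #ι ∧ ∀ i ∈ S, ∀ j ∈ S, f i ≠ g j) ∨
      ∃ W : Set V, #W < #ι ∧ #{i | f i ∈ W ∧ g i ∈ W} = #ι := by
  obtain ⟨M, hM⟩ := zorn_subset {S : Set ι | ∀ i ∈ S, ∀ j ∈ S, f i ≠ g j} (by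
    intro c hc hchain
    refine ⟨⋃₀ c, ?_, fun s hs ↦ Set.subset_sUnion_of_mem hs⟩
    rintro i ⟨s, hs, hi⟩ j ⟨t, ht, hj⟩
    rcases hchain.total hs ht with h | h
    · exact hc ht i (h hi) j hj
    · exact hc hs i hi j (h hj))
  by_contra! H
  obtain ⟨H₁, H₂⟩ := H
  have small (S : Set ι) (hS : ∀ i ∈ S, ∀ j ∈ S, f i ≠ g j) : #S < #ι :=
    (mk_set_le S).lt_of_ne fun h ↦ by
      obtain ⟨i, hi, j, hj, hij⟩ := H₁ S h
      exact hS i hi j hj hij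
  have hMlt : #M < #ι := small M hM.prop
  set W : Set V := f '' M ∪ g '' M
  have hWlt : #W < #ι := (mk_union_le _ _).trans_lt <|
    add_lt_of_lt hι (mk_image_le.trans_lt hMlt) (mk_image_le.trans_lt hMlt)
  have hA : #{i | f i ∈ W ∧ g i ∉ W} < #ι := small _ fun i hi j hj h ↦ hj.2 (h ▸ hi.1)
  have hB : #{i | f i ∉ W ∧ g i ∈ W} < #ι := small _ fun i hi j hj h ↦ hi.1 (h ▸ hj.2)
  have hC : #{i | f i ∈ W ∧ g i ∈ W} < #ι := (mk_set_le _).lt_of_ne (H₂ W hWlt)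
  have hcover : (Set.univ : Set ι) ⊆ (M ∪ {i | f i ∈ W ∧ g i ∉ W}) ∪
      ({i | f i ∉ W ∧ g i ∈ W} ∪ {i | f i ∈ W ∧ g i ∈ W}) := by
    intro i _
    by_contra hi
    have hiM : i ∉ M := fun h ↦ hi (.inl (.inl h))
    have hi' : f i ∉ W ∧ g i ∉ W := by
      simp only [Set.mem_union, Set.mem_ofPred_eq] at hi
      tauto
    apply hiM
    refine hM.le_of_ge (y := insert i M) ?_ (Set.subset_insert i M) (Set.mem_insert i M)
    rintro j (rfl | hj) k (rfl | hk)
    · exact hfg _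
    · exact fun h ↦ hi'.1 (.inr ⟨k, hk, h.symm⟩)
    · exact fun h ↦ hi'.2 (.inl ⟨j, hj, h⟩)
    · exact hM.prop j hj k hk
  have := mk_le_mk_of_subset hcover
  rw [mk_univ] at this
  exact absurd this (not_le.2 ((mk_union_le _ _).trans_lt (add_lt_of_lt hι
    ((mk_union_le _ _).trans_lt (add_lt_of_lt hι hMlt hA))
    ((mk_union_le _ _).trans_lt (add_lt_of_lt hι hB hC)))))

/-- A family concentrated on a small set of pairs has fibers of every size allowed by the
pigeonhole principle. -/
theorem exists_lt_mk_fiber {ι V : Type u} (f g : ι → V) (hι : ℵ₀ ≤ #ι) {W : Set V}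
    (hW : #W < #ι) (hC : #{i | f i ∈ W ∧ g i ∈ W} = #ι) {θ : Cardinal.{u}} (hθ : θ < #ι) :
    ∃ p : V × V, θ < #{i | (f i, g i) = p} := by
  by_contra! H
  have hsub : {i | f i ∈ W ∧ g i ∈ W} ⊆ ⋃ p : W × W, {i | (f i, g i) = (p.1.1, p.2.1)} :=
    fun i hi ↦ Set.mem_iUnion.2 ⟨(⟨f i, hi.1⟩, ⟨g i, hi.2⟩), rfl⟩
  have hle : #ι ≤ #(W × W) * θ := by
    rw [← hC]
    exact (mk_le_mk_of_subset hsub).trans <| (mk_iUnion_le _).trans <|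
      mul_le_mul_right (ciSup_le' fun p ↦ H _) _
  refine hle.not_gt (mul_lt_of_lt hι ?_ hθ)
  simpa using mul_lt_of_lt hι hW hW

theorem exists_separated_of_isRegular {ι V : Type u} (f g : ι → V) (hfg : ∀ i, f i ≠ g i)
    (hι : (#ι).IsRegular) : ∃ S : Set ι, #S = #ι ∧ ∀ i ∈ S, ∀ j ∈ S, f i ≠ g j := by
  obtain h | ⟨W, hW, hC⟩ := exists_separated_or_concentrated f g hfg hι.aleph0_le
  · exact h
  obtain ⟨p, S, hS, hle, hp⟩ := infinite_pigeonhole_set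
    (fun i : {i | f i ∈ W ∧ g i ∈ W} ↦ ((⟨f i, i.2.1⟩, ⟨g i, i.2.2⟩) : W × W)) #ι hC.ge
    hι.aleph0_le (by
      rw [hι.cof_ord]
      simpa using mul_lt_of_lt hι.aleph0_le hW hW)
  refine ⟨S, (mk_set_le S).antisymm hle, fun i hi j hj h ↦ hfg i ?_⟩
  have hgi := congrArg (fun q ↦ (q.2 : V)) ((hp hi).trans (hp hj).symm)
  exact h.trans hgi.symm

/-- If `f i ≠ g i` for all `i` in an infinite index set, then some subfamily of full size has
`f i ≠ g j` throughout. -/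
theorem exists_separated {ι V : Type u} (f g : ι → V) (hfg : ∀ i, f i ≠ g i)
    (hι : ℵ₀ ≤ #ι) : ∃ S : Set ι, #S = #ι ∧ ∀ i ∈ S, ∀ j ∈ S, f i ≠ g j := by
  by_cases hreg : (#ι).IsRegular
  · exact exists_separated_of_isRegular f g hfg hreg
  obtain h | ⟨W, hW, hC⟩ := exists_separated_or_concentrated f g hfg hι
  · exact h
  have hcof : (#ι).ord.cof < #ι := (Ordinal.cof_ord_le _).lt_of_ne fun h ↦ hreg ⟨hι, h.ge⟩
  obtain ⟨s, hs, hs'⟩ := Ordinal.exists_ord_cof_eq (#ι).ord.ToType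
  rw [Ordinal.cof_toType] at hs'
  have hscard : #s = (#ι).ord.cof := by simpa using congrArg Ordinal.card hs'
  have hsreg : (#s).IsRegular := hscard ▸ isRegular_cof (isSuccLimit_ord hι)
  choose p hp using fun x : s ↦ exists_lt_mk_fiber f g hι hW hC ((mk_Iio_lt x.1 (by simp)).trans_eq (mk_ord_toType _))
  have hpne (x : s) : (p x).1 ≠ (p x).2 := by
    obtain ⟨⟨i, hi⟩⟩ := mk_ne_zero_iff.1 (hp x).ne_bot
    rw [← show (f i, g i) = p x from hi]
    exact hfg i
  obtain ⟨t, ht, htsep⟩ := exists_separated_of_isRegular (fun x ↦ (p x).1) (fun x ↦ (p x).2)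
    hpne hsreg
  refine ⟨{i | ∃ x ∈ t, (f i, g i) = p x}, (mk_set_le _).antisymm ?_, ?_⟩
  · by_contra! hlt
    have htcof (y : (#ι).ord.ToType) : ∃ x ∈ t, y ≤ x.1 := by
      obtain ⟨z, hz, hyz⟩ := hs y
      by_contra! hlt
      have hsub : t ⊆ Set.Iio ⟨z, hz⟩ := fun x hx ↦ (hlt x hx).trans_le hyz
      refine ((mk_le_mk_of_subset hsub).trans_lt (mk_Iio_lt _ ?_)).ne ht
      rw [hs', hscard]
    have hcover : (Set.univ : Set (#ι).ord.ToType) ⊆ ⋃ x : t, Set.Iic x.1.1 := fun y _ ↦ by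
      obtain ⟨x, hx, hyx⟩ := htcof y
      exact Set.mem_iUnion.2 ⟨⟨x, hx⟩, hyx⟩
    have hle := (mk_le_mk_of_subset hcover).trans (mk_iUnion_le _)
    rw [mk_univ, mk_ord_toType] at hle
    refine hle.not_gt (mul_lt_of_lt hι (ht.trans_lt (hscard ▸ hcof))
      ((ciSup_le' (a := #{i | ∃ x ∈ t, (f i, g i) = p x} + 1) fun x ↦ ?_).trans_lt
        (add_lt_of_lt hι hlt (one_lt_aleph0.trans_le hι))))
    rw [← Set.Iio_insert]
    refine mk_insert_le.trans (add_le_add_left ((hp x.1).le.trans (mk_le_mk_of_subset ?_)) 1)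
    exact fun i hi ↦ ⟨x.1, x.2, hi⟩
  · rintro i ⟨x, hx, hi⟩ j ⟨y, hy, hj⟩ h
    refine htsep x hx y hy ?_
    rw [← hi, ← hj]
    exact h

/-- Finitely many separations can be achieved simultaneously. -/
theorem exists_forall_separated {ι V : Type u} {κ : Type*} (f g : κ → ι → V) (T : Finset κ)
    (hfg : ∀ k ∈ T, ∀ i, f k i ≠ g k i) (hι : ℵ₀ ≤ #ι) :
    ∃ S : Set ι, #S = #ι ∧ ∀ k ∈ T, ∀ i ∈ S, ∀ j ∈ S, f k i ≠ g k j := by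
  classical
  induction T using Finset.induction_on with
  | empty => exact ⟨Set.univ, mk_univ, by simp⟩
  | insert k T _ ih =>
    obtain ⟨S, hS, hsep⟩ := ih fun k hk ↦ hfg k (Finset.mem_insert_of_mem hk)
    obtain ⟨S', hS', hsep'⟩ := exists_separated (fun i : S ↦ f k i) (fun i : S ↦ g k i)
      (fun i ↦ hfg k (Finset.mem_insert_self k T) i) (hS ▸ hι)
    refine ⟨(↑) '' S', ?_, ?_⟩
    · rw [mk_image_eq Subtype.val_injective, hS', hS]
    rintro l hl _ ⟨i, hi, rfl⟩ _ ⟨j, hj, rfl⟩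
    rcases Finset.mem_insert.1 hl with rfl | hl
    · exact hsep' i hi j hj
    · exact hsep l hl i i.2 j j.2

end Cardinal

/-- If common entries of two lists occur at the same positions, then pairs of common entries occur
in the same order. -/
theorem List.pair_sublist_of_getElem?_eq {α : Type*} {l l' : List α} {u v : α}
    (h : ∀ (i j : ℕ) (x : α), l[i]? = some x → l'[j]? = some x → i = j) (hu : u ∈ l')
    (hv : v ∈ l') (huv : [u, v].Sublist l) : [u, v].Sublist l' := by
  have hidx (i : ℕ) (x : α) (hx : x ∈ l') (hi : l[i]? = some x) : l'[i]? = some x := by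
    obtain ⟨j, hj⟩ := List.mem_iff_getElem?.1 hx
    rwa [h i j x hi hj]
  obtain ⟨φ, hφ⟩ := List.sublist_iff_exists_fin_orderEmbedding_get_eq.1 huv
  obtain ⟨i, hi⟩ : ∃ i, i = φ ⟨0, by simp⟩ := ⟨_, rfl⟩
  obtain ⟨j, hj⟩ : ∃ j, j = φ ⟨1, by simp⟩ := ⟨_, rfl⟩
  have hij : i < j := by rw [hi, hj]; exact φ.lt_iff_lt.2 Nat.zero_lt_one
  obtain ⟨hi', rfl⟩ := List.getElem?_eq_some_iff.1 <|
    hidx i u hu (by simpa [hi] using (hφ ⟨0, by simp⟩).symm)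
  obtain ⟨hj', rfl⟩ := List.getElem?_eq_some_iff.1 <|
    hidx j v hv (by simpa [hj] using (hφ ⟨1, by simp⟩).symm)
  exact List.map_getElem_sublist (l := l') (is := [⟨i, hi'⟩, ⟨j, hj'⟩]) (by simpa using hij)

/-- **Dirac's question for cardinals of uncountable cofinality.**  If `δ` is an infinite
cardinal of uncountable cofinality and `a`, `b` are joined by `δ` pairwise edge-disjoint
paths, then they are joined by `δ` pairwise edge-disjoint, pairwise order-compatible
paths. -/
theorem dirac_uncountable_cofinality {V E : Type u} (G : Multigraph V E)
    (δ : Cardinal.{u}) (hδ : Cardinal.aleph0 ≤ δ)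
    (hcof : Cardinal.aleph0 < δ.ord.cof) (a b : V)
    (ι : Type u) (P : ι → G.Path a b) (hcard : Cardinal.mk ι = δ)
    (hdisj : Pairwise fun i j => Multigraph.EdgeDisjoint (P i) (P j)) :
    ∃ (κ : Type u) (Q : κ → G.Path a b), Cardinal.mk κ = δ ∧
      (Pairwise fun i j => Multigraph.EdgeDisjoint (Q i) (Q j)) ∧
      (Pairwise fun i j => Multigraph.OrderCompatible (Q i) (Q j)) := by
  have hι : Cardinal.aleph0 ≤ Cardinal.mk ι := hcard ▸ hδ
  obtain ⟨⟨n⟩, hn⟩ := Cardinal.infinite_pigeonhole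
    (fun i ↦ ULift.up.{u} (P i).verts.length) hι (by rw [hcard]; simpa using hcof)
  set L : Set ι := (fun i ↦ ULift.up.{u} (P i).verts.length) ⁻¹' {⟨n⟩}
  have hL (i : L) : (P i).verts.length = n := congrArg ULift.down i.2
  obtain ⟨S, hS, hsep⟩ := Cardinal.exists_forall_separated
    (fun (k : ℕ × ℕ) (i : L) ↦ (P i).verts[k.1]?) (fun k i ↦ (P i).verts[k.2]?)
    (Finset.range n).offDiag (by
      intro k hk i h
      simp only [Finset.mem_offDiag, Finset.mem_range] at hk
      exact hk.2.2 ((List.getElem?_inj (by rw [hL i]; exact hk.1) (P i).nodup).1 h)) (hn ▸ hι)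
  refine ⟨S, fun i ↦ P i.1, hS.trans (hn.trans hcard), fun i j hij ↦ hdisj ?_, fun i j _ ↦ ?_⟩
  · exact fun h ↦ hij (Subtype.ext (Subtype.ext h))
  have key (i j : S) (k l : ℕ) (x : V) (hk : (P i.1).verts[k]? = some x)
      (hl : (P j.1).verts[l]? = some x) : k = l := by
    by_contra hkl
    refine hsep (k, l) ?_ i i.2 j j.2 (hk.trans hl.symm)
    simp only [Finset.mem_offDiag, Finset.mem_range]
    exact ⟨hL i ▸ (List.getElem?_eq_some_iff.1 hk).1,
      hL j ▸ (List.getElem?_eq_some_iff.1 hl).1, hkl⟩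
  exact fun u v hu hv hu' hv' ↦ ⟨List.pair_sublist_of_getElem?_eq (key i j) hu' hv',
    List.pair_sublist_of_getElem?_eq (key j i) hu hv⟩
end

section
/- Let G be a graph (possibly with parallel edges) and let δ be any finite or infinite cardinal. Define a ≈_δ b to mean that G contains a family of δ pairwise edge-disjoint a–b paths that are pairwise order-compatible (in particular, a ≈_δ a holds via trivial one-vertex paths). Then ≈_δ is an equivalence relation on the vertex set of G: it is reflexive, symmetric, and transitive. -/
universe u

/-- Stable matchings exist for a two-sided market with contracts `C`, where each side ranks its
contracts by a key in a well-order. -/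
theorem exists_stable_matching {C : Type*} {I J A B : Type*}
    [LinearOrder A] [WellFoundedLT A] [LinearOrder B] [WellFoundedLT B]
    (f : C → I) (g : C → J) (α : C → A) (β : C → B)
    (hα : ∀ c d, f c = f d → α c = α d → c = d)
    (hβ : ∀ c d, g c = g d → β c = β d → c = d) :
    ∃ M : Set C, M.InjOn f ∧ M.InjOn g ∧
      ∀ c, (∃ m ∈ M, f m = f c ∧ α m ≤ α c) ∨ (∃ m ∈ M, g m = g c ∧ β m ≤ β c) := by
  let prop : Set C → Set C := fun R => {c | ∀ d, f d = f c → α d < α c → d ∈ R}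
  have hprop : Monotone prop := fun R S h c hc d h₁ h₂ => h (hc d h₁ h₂)
  let F : Set C →o Set C :=
    { toFun := fun R => {c | ∃ d ∈ prop R, g d = g c ∧ β d < β c}
      monotone' := fun R S h c ⟨d, hd, h₁, h₂⟩ => ⟨d, hprop h hd, h₁, h₂⟩ }
  obtain ⟨R, hR⟩ : ∃ R, F R = R := ⟨F.lfp, F.map_lfp⟩
  have memR : ∀ c, c ∈ R ↔ ∃ d ∈ prop R, g d = g c ∧ β d < β c := fun c => by
    conv_lhs => rw [← hR]
    rfl
  refine ⟨prop R \ R, ?_, ?_, ?_⟩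
  · rintro c ⟨hc, hcR⟩ d ⟨hd, hdR⟩ h
    rcases lt_trichotomy (α c) (α d) with h' | h' | h'
    · exact absurd (hd c h h') hcR
    · exact hα c d h h'
    · exact absurd (hc d h.symm h') hdR
  · rintro c ⟨hc, hcR⟩ d ⟨hd, hdR⟩ h
    rcases lt_trichotomy (β c) (β d) with h' | h' | h'
    · exact absurd ((memR d).2 ⟨c, hc, h, h'⟩) hdR
    · exact hβ c d h h'
    · exact absurd ((memR c).2 ⟨d, hd, h.symm, h'⟩) hcR
  · intro c
    by_cases hc : c ∈ R
    · right
      obtain ⟨d, hd, hdg, hdβ⟩ := (memR c).1 hc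
      obtain ⟨m, ⟨hm, hmg⟩, hmin⟩ := (InvImage.wf β (wellFounded_lt (α := B))).has_min
        {d | d ∈ prop R ∧ g d = g c} ⟨d, hd, hdg⟩
      refine ⟨m, ⟨hm, fun hmR => ?_⟩, hmg, ?_⟩
      · obtain ⟨d', hd', h₁, h₂⟩ := (memR m).1 hmR
        exact hmin d' ⟨hd', h₁.trans hmg⟩ h₂
      · exact (not_lt.1 (hmin d ⟨hd, hdg⟩)).trans hdβ.le
    · left
      obtain ⟨m, ⟨hm, hmf⟩, hmin⟩ := (InvImage.wf α (wellFounded_lt (α := A))).has_min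
        {d | d ∉ R ∧ f d = f c} ⟨c, hc, rfl⟩
      refine ⟨m, ⟨fun d h₁ h₂ => ?_, hm⟩, hmf, not_lt.1 (hmin c ⟨hc, rfl⟩)⟩
      by_contra hd
      exact hmin d ⟨hd, h₁.trans hmf⟩ h₂

open Classical in
theorem List.Nodup.pair_sublist_iff {V : Type*} {l : List V} (hl : l.Nodup) {u v : V}
    (hu : u ∈ l) (hv : v ∈ l) : [u, v].Sublist l ↔ l.idxOf u < l.idxOf v := by
  induction l with
  | nil => simp at hu
  | cons w l ih =>
    obtain ⟨hw, hl⟩ := List.nodup_cons.1 hl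
    by_cases huw : w = u
    · subst huw
      by_cases hvw : w = v
      · subst hvw
        simp [List.cons_sublist_cons, hw]
      · have : v ∈ l := by simpa [Ne.symm hvw] using hv
        simp [List.cons_sublist_cons, this, List.idxOf_cons_ne _ hvw]
    · have hu' : u ∈ l := by simpa [Ne.symm huw] using hu
      rw [List.sublist_cons_iff]
      by_cases hvw : w = v
      · subst hvw
        have : ¬ [u, w].Sublist l := fun h => hw (h.subset (by simp))
        simp [this, Ne.symm huw]
      · have hv' : v ∈ l := by simpa [Ne.symm hvw] using hv
        simp [ih hl hu' hv', List.idxOf_cons_ne _ hvw, List.idxOf_cons_ne _ huw, Ne.symm huw]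

namespace Multigraph

variable {V E : Type u} {G : Multigraph V E} {a b c : V}

/-- The one-vertex path. -/
def Path.nil (G : Multigraph V E) (a : V) : G.Path a a where
  verts := [a]
  edges := []
  nodup := by simp
  length_eq := rfl
  head_eq := rfl
  last_eq := rfl
  inc i h := by simp at h

/-- The same path traversed backwards. -/
def Path.reverse (P : G.Path a b) : G.Path b a where
  verts := P.verts.reverse
  edges := P.edges.reverse
  nodup := List.nodup_reverse.2 P.nodup
  length_eq := by simpa using P.length_eq
  head_eq := by simpa using P.last_eq
  last_eq := by simpa using P.head_eq
  inc i h := by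
    have hl := P.length_eq
    rw [List.length_reverse] at h
    have := P.inc (P.edges.length - 1 - i) (by omega)
    simp only [List.getElem_reverse]
    rw [this, Sym2.eq_swap]
    exact congrArg₂ (fun x y => s(x, y)) (getElem_congr_idx (by omega))
      (getElem_congr_idx (by omega))

theorem OrderCompatible.reverse {P Q : G.Path a b} (h : OrderCompatible P Q) :
    OrderCompatible P.reverse Q.reverse := by
  intro u v h₁ h₂ h₃ h₄
  simp only [Path.reverse, List.mem_reverse] at *
  rw [← List.reverse_sublist, ← List.reverse_sublist (l₂ := Q.verts.reverse)]
  simpa using h v u h₂ h₁ h₄ h₃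

theorem Path.start_mem (P : G.Path a b) : a ∈ P.verts :=
  List.mem_of_mem_head? P.head_eq

theorem Path.end_mem (P : G.Path a b) : b ∈ P.verts :=
  List.mem_of_getLast? P.last_eq

open Classical in
/-- The position of a vertex along a path. -/
noncomputable def Path.pos (P : G.Path a b) (x : V) : ℕ := P.verts.idxOf x

open Classical in
theorem Path.pos_lt {P : G.Path a b} {x : V} (hx : x ∈ P.verts) :
    P.pos x < P.verts.length := List.idxOf_lt_length_of_mem hx

open Classical in
theorem Path.getElem_pos {P : G.Path a b} {x : V} (hx : x ∈ P.verts) :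
    P.verts[P.pos x]'(P.pos_lt hx) = x := List.getElem_idxOf _

open Classical in
theorem Path.pos_getElem (P : G.Path a b) {k : ℕ} (hk : k < P.verts.length) :
    P.pos P.verts[k] = k := P.nodup.idxOf_getElem k hk

theorem Path.eq_of_pos_eq {P : G.Path a b} {x y : V} (hx : x ∈ P.verts) (hy : y ∈ P.verts)
    (h : P.pos x = P.pos y) : x = y := by
  rw [← Path.getElem_pos hx, ← Path.getElem_pos hy]
  simp only [h]

theorem Path.mem_take_verts {P : G.Path a b} {n : ℕ} {x : V} :
    x ∈ P.verts.take n ↔ x ∈ P.verts ∧ P.pos x < n := by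
  constructor
  · intro h
    obtain ⟨k, hk, rfl⟩ := List.mem_take_iff_getElem.1 h
    rw [P.pos_getElem]
    exact ⟨List.getElem_mem _, by omega⟩
  · rintro ⟨h, h'⟩
    have := Path.pos_lt h
    exact List.mem_take_iff_getElem.2 ⟨P.pos x, by omega, Path.getElem_pos h⟩

theorem Path.mem_drop_verts {P : G.Path a b} {n : ℕ} {x : V} :
    x ∈ P.verts.drop n ↔ x ∈ P.verts ∧ n ≤ P.pos x := by
  constructor
  · intro h
    obtain ⟨k, hk, rfl⟩ := List.mem_drop_iff_getElem.1 h
    rw [P.pos_getElem]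
    exact ⟨List.getElem_mem _, by omega⟩
  · rintro ⟨h, h'⟩
    have := Path.pos_lt h
    refine List.mem_drop_iff_getElem.2 ⟨P.pos x - n, by omega, ?_⟩
    simp only [Nat.add_sub_cancel' h', Path.getElem_pos h]

theorem orderCompatible_iff_pos {P Q : G.Path a b} :
    OrderCompatible P Q ↔ ∀ u v, u ∈ P.verts → v ∈ P.verts → u ∈ Q.verts → v ∈ Q.verts →
      (P.pos u < P.pos v ↔ Q.pos u < Q.pos v) := by
  refine forall_congr' fun u => forall_congr' fun v => forall_congr' fun h₁ =>
    forall_congr' fun h₂ => forall_congr' fun h₃ => forall_congr' fun h₄ => ?_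
  rw [P.nodup.pair_sublist_iff h₁ h₂, Q.nodup.pair_sublist_iff h₃ h₄]
  rfl

/-- Follow `P` up to `x`, then `Q` from `x` on. -/
noncomputable def Path.switch (P : G.Path a b) (Q : G.Path b c) (x : V)
    (hP : x ∈ P.verts) (hQ : x ∈ Q.verts)
    (hPQ : ∀ w, w ∈ P.verts → w ∈ Q.verts → P.pos w < P.pos x → Q.pos w ≤ Q.pos x) :
    G.Path a c where
  verts := P.verts.take (P.pos x) ++ Q.verts.drop (Q.pos x)
  edges := P.edges.take (P.pos x) ++ Q.edges.drop (Q.pos x)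
  nodup := by
    refine List.Nodup.append (P.nodup.sublist (List.take_sublist _ _))
      (Q.nodup.sublist (List.drop_sublist _ _)) fun w h₁ h₂ => ?_
    rw [mem_take_verts] at h₁
    rw [mem_drop_verts] at h₂
    have := Path.eq_of_pos_eq h₂.1 hQ (le_antisymm (hPQ w h₁.1 h₂.1 h₁.2) h₂.2)
    subst this
    exact lt_irrefl _ h₁.2
  length_eq := by
    have := Path.pos_lt hP
    have := Path.pos_lt hQ
    have := P.length_eq
    have := Q.length_eq
    simp only [List.length_append, List.length_take, List.length_drop]
    omega
  head_eq := by
    rw [List.head?_append, List.head?_drop, List.getElem?_eq_getElem (Path.pos_lt hQ),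
      Path.getElem_pos hQ]
    rcases Nat.eq_zero_or_pos (P.pos x) with h | h
    · have h' := P.head_eq
      have := Path.getElem_pos hP
      simp only [h] at this
      rw [List.head?_eq_getElem?, List.getElem?_eq_getElem (by have := P.length_eq; omega),
        this] at h'
      simpa [h] using h'
    · rw [List.head?_take, if_neg h.ne', P.head_eq]
      rfl
  last_eq := by
    rw [List.getLast?_append, List.getLast?_drop, if_neg (not_le.2 (Path.pos_lt hQ)), Q.last_eq]
    rfl
  inc i h := by
    have h₁ := Path.pos_lt hP
    have h₂ := Path.pos_lt hQ
    have h₃ := P.length_eq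
    have h₄ := Q.length_eq
    simp only [List.length_append, List.length_take, List.length_drop] at h
    simp only [List.getElem_append, List.length_take, List.getElem_take, List.getElem_drop]
    rcases lt_trichotomy (i + 1) (P.pos x) with hi | hi | hi
    · rw [dif_pos (by omega), dif_pos (by omega), dif_pos (by omega), P.inc i (by omega)]
    · rw [dif_pos (by omega), dif_pos (by omega), dif_neg (by omega), P.inc i (by omega)]
      exact congrArg₂ (fun x y => s(x, y)) rfl <| (getElem_congr_idx hi).trans <|
        (Path.getElem_pos hP).trans <| (Path.getElem_pos hQ).symm.trans <|
          getElem_congr_idx (by omega)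
    · rw [dif_neg (by omega), dif_neg (by omega), dif_neg (by omega), Q.inc _ (by omega)]
      exact congrArg₂ (fun x y => s(x, y)) (getElem_congr_idx (by omega))
        (getElem_congr_idx (by omega))

section Switch

variable {P : G.Path a b} {Q : G.Path b c} {x : V} {hP : x ∈ P.verts} {hQ : x ∈ Q.verts}
  {hPQ : ∀ w, w ∈ P.verts → w ∈ Q.verts → P.pos w < P.pos x → Q.pos w ≤ Q.pos x}

theorem Path.mem_switch_verts {w : V} : w ∈ (P.switch Q x hP hQ hPQ).verts ↔
    (w ∈ P.verts ∧ P.pos w < P.pos x) ∨ (w ∈ Q.verts ∧ Q.pos x ≤ Q.pos w) := by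
  rw [← mem_take_verts, ← mem_drop_verts, ← List.mem_append]
  rfl

theorem Path.pos_switch_of_lt {w : V} (hw : w ∈ P.verts) (h : P.pos w < P.pos x) :
    (P.switch Q x hP hQ hPQ).pos w = P.pos w := by
  have h₁ := Path.pos_lt hw
  have hlt : P.pos w < (P.switch Q x hP hQ hPQ).verts.length := by
    simp only [switch, List.length_append, List.length_take]
    omega
  have := Path.pos_getElem _ hlt
  simp only [switch] at this ⊢
  rw [List.getElem_append_left (by rw [List.length_take]; omega), List.getElem_take,
    Path.getElem_pos hw] at this
  exact this

theorem Path.pos_switch_of_le {w : V} (hw : w ∈ Q.verts) (h : Q.pos x ≤ Q.pos w) :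
    (P.switch Q x hP hQ hPQ).pos w = P.pos x + (Q.pos w - Q.pos x) := by
  have h₁ := Path.pos_lt hw
  have h₂ := Path.pos_lt hP
  have hl : (P.verts.take (P.pos x)).length = P.pos x := by rw [List.length_take]; omega
  have hlt : P.pos x + (Q.pos w - Q.pos x) < (P.switch Q x hP hQ hPQ).verts.length := by
    simp only [switch, List.length_append, List.length_take, List.length_drop]
    omega
  have := Path.pos_getElem _ hlt
  simp only [switch] at this ⊢
  rw [List.getElem_append_right (by omega), List.getElem_drop] at this
  simp only [hl, Nat.add_sub_cancel_left, Nat.add_sub_cancel' h, Path.getElem_pos hw] at this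
  exact this

theorem Path.mem_switch_edges {e : E} : e ∈ (P.switch Q x hP hQ hPQ).edges ↔
    e ∈ P.edges.take (P.pos x) ∨ e ∈ Q.edges.drop (Q.pos x) := List.mem_append

end Switch

/-- A choice of places at which to leave the paths `P i` for the paths `Q j`, such that the
resulting concatenations are pairwise edge-disjoint and order-compatible. -/
structure IsSwitching {ι κ : Type*} (P : ι → G.Path a b) (Q : κ → G.Path b c)
    (M : Set (ι × κ × V)) : Prop where
  mem_left : ∀ m ∈ M, m.2.2 ∈ (P m.1).verts
  mem_right : ∀ m ∈ M, m.2.2 ∈ (Q m.2.1).verts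
  injOn_left : M.InjOn fun m => m.1
  injOn_right : M.InjOn fun m => m.2.1
  vertex : ∀ m ∈ M, ∀ n ∈ M, ∀ w, w ∈ (P m.1).verts → w ∈ (Q n.2.1).verts →
    (P m.1).pos w < (P m.1).pos m.2.2 → (Q n.2.1).pos w ≤ (Q n.2.1).pos n.2.2
  edge : ∀ m ∈ M, ∀ n ∈ M, ∀ e, e ∈ (P m.1).edges.take ((P m.1).pos m.2.2) →
    e ∉ (Q n.2.1).edges.drop ((Q n.2.1).pos n.2.2)
  total : (∀ i, ∃ m ∈ M, m.1 = i) ∨ (∀ j, ∃ m ∈ M, m.2.1 = j)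

open Classical in
theorem exists_isSwitching {ι κ : Type u} (P : ι → G.Path a b) (Q : κ → G.Path b c)
    (hQ : Pairwise fun i j => EdgeDisjoint (Q i) (Q j)) :
    ∃ M, IsSwitching P Q M := by
  let C := {m : ι × κ × V // m.2.2 ∈ (P m.1).verts ∧ m.2.2 ∈ (Q m.2.1).verts}
  /- Among the places at which `P i` may be left at a given vertex, the one leading to the path
  `Q j` which contains the last edge used is preferred. -/
  let flag : C → Prop := fun m => ∃ k, ∃ hk : k < (P m.1.1).edges.length,
    k + 1 = (P m.1.1).pos m.1.2.2 ∧ (P m.1.1).edges[k] ∈ (Q m.1.2.1).edges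
  let α : C → ℕ ×ₗ (ℕ ×ₗ Cardinal.{u}) := fun m =>
    toLex ((P m.1.1).pos m.1.2.2, toLex (if flag m then 0 else 1, embeddingToCardinal m.1.2.1))
  let β : C → ℕ ×ₗ Cardinal.{u} := fun m =>
    toLex ((Q m.1.2.1).verts.length - (Q m.1.2.1).pos m.1.2.2, embeddingToCardinal m.1.1)
  obtain ⟨M, hMf, hMg, hM⟩ := exists_stable_matching
    (fun m : C => m.1.1) (fun m : C => m.1.2.1) α β
    (by
      rintro ⟨⟨i, j, x⟩, hx⟩ ⟨⟨i', j', y⟩, hy⟩ (rfl : i = i') h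
      simp only [α, EmbeddingLike.apply_eq_iff_eq, Prod.mk.injEq] at h
      obtain ⟨h₁, -, rfl⟩ := h
      obtain rfl := Path.eq_of_pos_eq hx.1 hy.1 h₁
      rfl)
    (by
      rintro ⟨⟨i, j, x⟩, hx⟩ ⟨⟨i', j', y⟩, hy⟩ (rfl : j = j') h
      simp only [β, EmbeddingLike.apply_eq_iff_eq, Prod.mk.injEq] at h
      obtain ⟨h₁, rfl⟩ := h
      have h₂ := Path.pos_lt hx.2
      have h₃ := Path.pos_lt hy.2
      obtain rfl := Path.eq_of_pos_eq hx.2 hy.2 (by dsimp only at h₁ h₂ h₃ ⊢; omega)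
      rfl)
  have stable : ∀ m ∈ M, ∀ n ∈ M, ∀ w (h₁ : w ∈ (P m.1.1).verts) (h₂ : w ∈ (Q n.1.2.1).verts),
      (P m.1.1).pos m.1.2.2 < (P m.1.1).pos w ∨
      ((P m.1.1).pos m.1.2.2 = (P m.1.1).pos w ∧
        (flag ⟨(m.1.1, n.1.2.1, w), h₁, h₂⟩ → flag m)) ∨
      (Q n.1.2.1).pos w ≤ (Q n.1.2.1).pos n.1.2.2 := by
    intro m hm n hn w h₁ h₂
    rcases hM ⟨(m.1.1, n.1.2.1, w), h₁, h₂⟩ with ⟨m', hm', h, hle⟩ | ⟨n', hn', h, hle⟩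
    · obtain rfl := hMf hm' hm h
      simp only [α, Prod.Lex.toLex_le_toLex] at hle
      rcases hle with hlt | ⟨heq, hle⟩
      · exact Or.inl hlt
      · refine Or.inr (Or.inl ⟨heq, fun hf => ?_⟩)
        by_contra hf'
        simp [hf, hf'] at hle
    · obtain rfl := hMg hn' hn h
      refine Or.inr (Or.inr ?_)
      simp only [β, Prod.Lex.toLex_le_toLex] at hle
      have h₃ := Path.pos_lt n'.2.2
      have h₄ := Path.pos_lt h₂
      omega
  refine ⟨Subtype.val '' M, ?_, ?_, ?_, ?_, ?_, ?_, ?_⟩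
  · rintro _ ⟨m, -, rfl⟩
    exact m.2.1
  · rintro _ ⟨m, -, rfl⟩
    exact m.2.2
  · rintro _ ⟨m, hm, rfl⟩ _ ⟨n, hn, rfl⟩ h
    rw [hMf hm hn h]
  · rintro _ ⟨m, hm, rfl⟩ _ ⟨n, hn, rfl⟩ h
    rw [hMg hm hn h]
  · rintro _ ⟨m, hm, rfl⟩ _ ⟨n, hn, rfl⟩ w h₁ h₂ hlt
    rcases stable m hm n hn w h₁ h₂ with h | ⟨h, -⟩ | h <;> omega
  · rintro _ ⟨m, hm, rfl⟩ _ ⟨n, hn, rfl⟩ e h₁ h₂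
    obtain ⟨k, hk, rfl⟩ := List.mem_take_iff_getElem.1 h₁
    obtain ⟨l, hl, hkl⟩ := List.mem_drop_iff_getElem.1 h₂
    have hPl := (P m.1.1).length_eq
    have hke : k < (P m.1.1).edges.length := by omega
    have hQl := (Q n.1.2.1).length_eq
    have he := (Q n.1.2.1).inc ((Q n.1.2.1).pos n.1.2.2 + l) (by omega)
    simp only [hkl] at he
    rw [(P m.1.1).inc k (by omega), Sym2.eq_iff] at he
    rcases he with ⟨-, he⟩ | ⟨he, -⟩
    · have hp := (P m.1.1).pos_getElem (k := k + 1) (by omega)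
      have hq := (Q n.1.2.1).pos_getElem (k := (Q n.1.2.1).pos n.1.2.2 + l + 1) (by omega)
      rw [← he] at hq
      rcases stable m hm n hn _ (List.getElem_mem (by omega))
        (he.symm ▸ List.getElem_mem _) with h | ⟨h, hf⟩ | h
      · omega
      · obtain ⟨k', hk', hk'', hmem⟩ := hf ⟨k, hke, hp.symm, hkl ▸ List.getElem_mem _⟩
        obtain rfl : k' = k := by omega
        have hj : m.1.2.1 = n.1.2.1 := by
          by_contra hne
          exact hQ hne _ hmem (hkl ▸ List.getElem_mem _)
        obtain rfl := hMg hm hn hj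
        have := Path.eq_of_pos_eq m.2.1 (List.getElem_mem (by omega)) h
        rw [← this] at hq
        omega
      · omega
    · have hp := (P m.1.1).pos_getElem (k := k) (by omega)
      have hq := (Q n.1.2.1).pos_getElem (k := (Q n.1.2.1).pos n.1.2.2 + l + 1) (by omega)
      rw [← he] at hq
      rcases stable m hm n hn _ (List.getElem_mem (by omega))
        (he.symm ▸ List.getElem_mem _) with h | ⟨h, -⟩ | h <;> omega
  · by_contra! h
    obtain ⟨⟨i, hi⟩, j, hj⟩ := h
    rcases hM ⟨(i, j, b), (P i).end_mem, (Q j).start_mem⟩ with ⟨m, hm, h, -⟩ | ⟨m, hm, h, -⟩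
    · exact hi _ ⟨m, hm, rfl⟩ h
    · exact hj _ ⟨m, hm, rfl⟩ h

namespace IsSwitching

variable {ι κ : Type u} {P : ι → G.Path a b} {Q : κ → G.Path b c} {M : Set (ι × κ × V)}

/-- The concatenations given by a switching. -/
noncomputable def path (hM : IsSwitching P Q M) (m : M) : G.Path a c :=
  (P m.1.1).switch (Q m.1.2.1) m.1.2.2 (hM.mem_left _ m.2) (hM.mem_right _ m.2)
    (hM.vertex _ m.2 _ m.2)

theorem mk_eq (hM : IsSwitching P Q M) {δ : Cardinal.{u}} (hι : Cardinal.mk ι = δ)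
    (hκ : Cardinal.mk κ = δ) : Cardinal.mk M = δ := by
  apply le_antisymm
  · rw [← hι]
    exact Cardinal.mk_le_of_injective (Set.injOn_iff_injective.1 hM.injOn_left)
  · rcases hM.total with h | h
    · rw [← hι]
      exact Cardinal.mk_le_of_surjective (f := fun m : M => m.1.1)
        fun i => let ⟨m, hm, h⟩ := h i; ⟨⟨m, hm⟩, h⟩
    · rw [← hκ]
      exact Cardinal.mk_le_of_surjective (f := fun m : M => m.1.2.1)
        fun i => let ⟨m, hm, h⟩ := h i; ⟨⟨m, hm⟩, h⟩

theorem edgeDisjoint (hM : IsSwitching P Q M)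
    (hP : Pairwise fun i j => EdgeDisjoint (P i) (P j))
    (hQ : Pairwise fun i j => EdgeDisjoint (Q i) (Q j)) :
    Pairwise fun m n => EdgeDisjoint (hM.path m) (hM.path n) := by
  intro m n hmn e h₁ h₂
  have hi : m.1.1 ≠ n.1.1 := fun h => hmn (Subtype.ext (hM.injOn_left m.2 n.2 h))
  have hj : m.1.2.1 ≠ n.1.2.1 := fun h => hmn (Subtype.ext (hM.injOn_right m.2 n.2 h))
  rcases Path.mem_switch_edges.1 h₁ with h₁ | h₁ <;>
    rcases Path.mem_switch_edges.1 h₂ with h₂ | h₂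
  · exact hP hi e (List.mem_of_mem_take h₁) (List.mem_of_mem_take h₂)
  · exact hM.edge _ m.2 _ n.2 e h₁ h₂
  · exact hM.edge _ n.2 _ m.2 e h₂ h₁
  · exact hQ hj e (List.mem_of_mem_drop h₁) (List.mem_of_mem_drop h₂)

/-- Vertices which some path of the switching passes before its switch. -/
def early (P : ι → G.Path a b) (M : Set (ι × κ × V)) : Set V :=
  {w | ∃ m ∈ M, w ∈ (P m.1).verts ∧ (P m.1).pos w < (P m.1).pos m.2.2}

theorem pos_of_mem_early (hM : IsSwitching P Q M) (m : M) {w : V} (hw : w ∈ early P M)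
    (h : w ∈ (hM.path m).verts) : w ∈ (P m.1.1).verts ∧
      (P m.1.1).pos w ≤ (P m.1.1).pos m.1.2.2 ∧ (hM.path m).pos w = (P m.1.1).pos w := by
  rcases Path.mem_switch_verts.1 h with h | h
  · exact ⟨h.1, h.2.le, Path.pos_switch_of_lt h.1 h.2⟩
  · obtain ⟨n, hn, h₁, h₂⟩ := hw
    have hle := hM.vertex n hn _ m.2 w h₁ h.1 h₂
    have := Path.eq_of_pos_eq h.1 (hM.mem_right _ m.2) (le_antisymm hle h.2)
    refine ⟨this ▸ hM.mem_left _ m.2, by rw [this], ?_⟩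
    refine (Path.pos_switch_of_le h.1 h.2).trans ?_
    rw [this]
    omega

theorem pos_of_notMem_early (hM : IsSwitching P Q M) (m : M) {w : V} (hw : w ∉ early P M)
    (h : w ∈ (hM.path m).verts) : w ∈ (Q m.1.2.1).verts ∧
      (Q m.1.2.1).pos m.1.2.2 ≤ (Q m.1.2.1).pos w ∧ (hM.path m).pos w =
        (P m.1.1).pos m.1.2.2 + ((Q m.1.2.1).pos w - (Q m.1.2.1).pos m.1.2.2) := by
  rcases Path.mem_switch_verts.1 h with h | h
  · exact absurd ⟨m.1, m.2, h⟩ hw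
  · exact ⟨h.1, h.2, Path.pos_switch_of_le h.1 h.2⟩

theorem pos_lt_pos (hM : IsSwitching P Q M) (m : M) {u v : V} (hu : u ∈ early P M)
    (hv : v ∉ early P M) (hum : u ∈ (hM.path m).verts) (hvm : v ∈ (hM.path m).verts) :
    (hM.path m).pos u < (hM.path m).pos v := by
  obtain ⟨-, h₁, h₂⟩ := hM.pos_of_mem_early m hu hum
  obtain ⟨-, h₃, h₄⟩ := hM.pos_of_notMem_early m hv hvm
  refine lt_of_le_of_ne (by omega) fun h => hv ?_
  rwa [← Path.eq_of_pos_eq hum hvm h]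

theorem orderCompatible (hM : IsSwitching P Q M)
    (hP : Pairwise fun i j => OrderCompatible (P i) (P j))
    (hQ : Pairwise fun i j => OrderCompatible (Q i) (Q j)) :
    Pairwise fun m n => OrderCompatible (hM.path m) (hM.path n) := by
  intro m n hmn
  have hi : m.1.1 ≠ n.1.1 := fun h => hmn (Subtype.ext (hM.injOn_left m.2 n.2 h))
  have hj : m.1.2.1 ≠ n.1.2.1 := fun h => hmn (Subtype.ext (hM.injOn_right m.2 n.2 h))
  rw [orderCompatible_iff_pos]
  intro u v hum hvm hun hvn
  by_cases hu : u ∈ early P M <;> by_cases hv : v ∈ early P M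
  · obtain ⟨h₁, -, h₁'⟩ := hM.pos_of_mem_early m hu hum
    obtain ⟨h₂, -, h₂'⟩ := hM.pos_of_mem_early m hv hvm
    obtain ⟨h₃, -, h₃'⟩ := hM.pos_of_mem_early n hu hun
    obtain ⟨h₄, -, h₄'⟩ := hM.pos_of_mem_early n hv hvn
    rw [h₁', h₂', h₃', h₄']
    exact orderCompatible_iff_pos.1 (hP hi) u v h₁ h₂ h₃ h₄
  · exact iff_of_true (hM.pos_lt_pos m hu hv hum hvm) (hM.pos_lt_pos n hu hv hun hvn)
  · exact iff_of_false (hM.pos_lt_pos m hv hu hvm hum).not_gt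
      (hM.pos_lt_pos n hv hu hvn hun).not_gt
  · obtain ⟨h₁, _, h₁'⟩ := hM.pos_of_notMem_early m hu hum
    obtain ⟨h₂, _, h₂'⟩ := hM.pos_of_notMem_early m hv hvm
    obtain ⟨h₃, _, h₃'⟩ := hM.pos_of_notMem_early n hu hun
    obtain ⟨h₄, _, h₄'⟩ := hM.pos_of_notMem_early n hv hvn
    have := orderCompatible_iff_pos.1 (hQ hj) u v h₁ h₂ h₃ h₄
    omega

end IsSwitching

end Multigraph

/-- **Theorem 2.**  For every cardinal `δ`, the relation `a ≈_δ b` ("there is a family of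
`δ` pairwise edge-disjoint, pairwise order-compatible `a`–`b` paths") is an equivalence
relation on the vertices of `G`. -/
theorem approx_equivalence {V E : Type u} (G : Multigraph V E) (δ : Cardinal.{u}) :
    Equivalence (fun a b : V =>
      ∃ (ι : Type u) (P : ι → G.Path a b), Cardinal.mk ι = δ ∧
        (Pairwise fun i j => Multigraph.EdgeDisjoint (P i) (P j)) ∧
        (Pairwise fun i j => Multigraph.OrderCompatible (P i) (P j))) := by
  refine ⟨fun a => ?_, ?_, ?_⟩
  · induction δ using Cardinal.inductionOn with
    | _ ι =>
      exact ⟨ι, fun _ => Multigraph.Path.nil G a, rfl, fun _ _ _ _ h => absurd h List.not_mem_nil,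
        fun _ _ _ _ _ _ _ _ _ => Iff.rfl⟩
  · rintro a b ⟨ι, P, hι, hE, hO⟩
    exact ⟨ι, fun i => (P i).reverse, hι,
      fun i j hij e h h' => hE hij e (List.mem_reverse.1 h) (List.mem_reverse.1 h'),
      fun i j hij => (hO hij).reverse⟩
  · rintro a b c ⟨ι, P, hι, hPE, hPO⟩ ⟨κ, Q, hκ, hQE, hQO⟩
    obtain ⟨M, hM⟩ := Multigraph.exists_isSwitching P Q hQE
    exact ⟨M, hM.path, hM.mk_eq hι hκ, hM.edgeDisjoint hPE hQE, hM.orderCompatible hPO hQO⟩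
end

section
/- Let G be a graph (possibly with parallel edges) and let a, b, c be three distinct vertices of G. Suppose G contains a countably infinite family of pairwise edge-disjoint, pairwise order-compatible a–b paths, and a countably infinite family of pairwise edge-disjoint, pairwise order-compatible b–c paths. Then G contains a countably infinite family of pairwise edge-disjoint, pairwise order-compatible a–c paths. -/
universe u

open Filter

namespace Multigraph

variable {V E : Type u} {G : Multigraph V E}

section

open scoped Classical

theorem pair_sublist_iff {l : List V} (hl : l.Nodup) (u v : V) :
    [u, v].Sublist l ↔ u ∈ l ∧ v ∈ l ∧ l.idxOf u < l.idxOf v := by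
  induction l with
  | nil => simp
  | cons x l ih =>
    rw [List.nodup_cons] at hl
    have ih := ih hl.2
    by_cases hu : x = u
    · subst hu
      by_cases hv : x = v
      · subst hv
        simp [List.cons_sublist_cons, hl.1]
      · simp [List.cons_sublist_cons, List.idxOf_cons_ne _ hv, Ne.symm hv]
    · have : [u, v].Sublist (x :: l) ↔ [u, v].Sublist l := by
        refine ⟨fun h => ?_, fun h => h.cons _⟩
        cases h with
        | cons _ h => exact h
        | cons_cons _ h => exact absurd rfl hu
      rw [this, ih, List.idxOf_cons_ne _ hu]
      by_cases hv : x = v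
      · subst hv
        simp [hl.1]
      · simp [List.idxOf_cons_ne _ hv, Ne.symm hv, Ne.symm hu]

theorem mem_drop_iff_le_idxOf {l : List V} (hl : l.Nodup) (n : ℕ) (x : V) :
    x ∈ l.drop n ↔ x ∈ l ∧ n ≤ l.idxOf x := by
  rw [List.mem_drop_iff_getElem]
  constructor
  · rintro ⟨i, hi, rfl⟩
    exact ⟨List.getElem_mem _, by rw [hl.idxOf_getElem]; omega⟩
  · rintro ⟨hx, hn⟩
    have := List.idxOf_lt_length_iff.2 hx
    refine ⟨l.idxOf x - n, by omega, ?_⟩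
    simp [Nat.add_sub_cancel' hn]

theorem mem_take_iff_idxOf_lt {l : List V} (n : ℕ) (x : V) :
    x ∈ l.take n ↔ x ∈ l ∧ l.idxOf x < n := by
  constructor
  · intro h
    refine ⟨List.mem_of_mem_take h, ?_⟩
    have h1 := List.idxOf_lt_length_iff.2 h
    have h2 : l.idxOf x = (l.take n).idxOf x := by
      conv_lhs => rw [← List.take_append_drop n l]
      exact List.idxOf_append_of_mem h
    rw [List.length_take] at h1
    omega
  · rintro ⟨hx, hn⟩
    have := List.idxOf_lt_length_iff.2 hx
    rw [List.mem_take_iff_getElem]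
    exact ⟨l.idxOf x, by omega, by simp⟩

namespace Path

variable {a b c : V}

/-- The position of a vertex on a path. -/
noncomputable def pos_s3 (P : G.Path a b) (x : V) : ℕ := P.verts.idxOf x

theorem pos_lt_s3 (P : G.Path a b) {x : V} (hx : x ∈ P.verts) : P.pos_s3 x < P.verts.length :=
  List.idxOf_lt_length_iff.2 hx

theorem getElem_pos_s3 (P : G.Path a b) {x : V} (hx : x ∈ P.verts) :
    P.verts[P.pos_s3 x]'(P.pos_lt_s3 hx) = x := by
  simp [pos_s3]

theorem pos_getElem_s3 (P : G.Path a b) (k : ℕ) (hk : k < P.verts.length) :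
    P.pos_s3 P.verts[k] = k :=
  P.nodup.idxOf_getElem k hk

theorem eq_of_pos_eq_s3 (P : G.Path a b) {x y : V} (hx : x ∈ P.verts)
    (h : P.pos_s3 x = P.pos_s3 y) : x = y :=
  (List.idxOf_inj hx).1 h

theorem start_mem_s3 (P : G.Path a b) : a ∈ P.verts := List.mem_of_mem_head? P.head_eq

theorem end_mem_s3 (P : G.Path a b) : b ∈ P.verts := List.mem_of_getLast? P.last_eq

theorem exists_edge (P : G.Path a b) (h : a ≠ b) : ∃ e, e ∈ P.edges := by
  by_contra! hne
  have h0 : P.edges = [] := List.eq_nil_iff_forall_not_mem.2 hne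
  have h1 := P.length_eq
  rw [h0] at h1
  obtain ⟨x, hx⟩ := List.length_eq_one_iff.1 h1
  have h2 := P.head_eq
  have h3 := P.last_eq
  rw [hx] at h2 h3
  simp at h2 h3
  exact h (h2.symm.trans h3)

theorem mem_ends_of_mem_take (P : G.Path a b) {n : ℕ} {e : E} (he : e ∈ P.edges.take n) :
    ∀ x ∈ G.ends e, x ∈ P.verts ∧ P.pos_s3 x ≤ n := by
  obtain ⟨k, hk, rfl⟩ := List.mem_take_iff_getElem.1 he
  have hl := P.length_eq
  have h1 : k + 1 < P.verts.length := by omega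
  rw [P.inc k h1]
  intro x hx
  rcases Sym2.mem_iff.1 hx with rfl | rfl
  · exact ⟨List.getElem_mem _, by rw [P.pos_getElem_s3]; omega⟩
  · exact ⟨List.getElem_mem _, by rw [P.pos_getElem_s3]; omega⟩

theorem mem_ends_of_mem_drop (P : G.Path a b) {n : ℕ} {e : E} (he : e ∈ P.edges.drop n) :
    ∀ x ∈ G.ends e, x ∈ P.verts ∧ n ≤ P.pos_s3 x := by
  obtain ⟨k, hk, rfl⟩ := List.mem_drop_iff_getElem.1 he
  have hl := P.length_eq
  have h1 : n + k + 1 < P.verts.length := by omega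
  rw [P.inc (n + k) h1]
  intro x hx
  rcases Sym2.mem_iff.1 hx with rfl | rfl
  · exact ⟨List.getElem_mem _, by rw [P.pos_getElem_s3]; omega⟩
  · exact ⟨List.getElem_mem _, by rw [P.pos_getElem_s3]; omega⟩

theorem inc_of_eq (P : G.Path a b) {i j k : ℕ} {x : V} (hk : k < P.verts.length)
    (hj : j < P.edges.length) (hij : j = i) (hik : k = i + 1)
    (hx : P.verts[i]'(by omega) = x) : G.ends P.edges[j] = s(x, P.verts[k]) := by
  subst hij hik hx
  exact P.inc j hk

/-- Follow `P` up to the vertex `w` and then `Q`, if the two segments meet only in `w`. -/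
noncomputable def splice (P : G.Path a b) (Q : G.Path b c) (w : V) (hP : w ∈ P.verts)
    (hQ : w ∈ Q.verts)
    (hw : ∀ x ∈ P.verts, P.pos_s3 x ≤ P.pos_s3 w → x ∈ Q.verts → Q.pos_s3 w ≤ Q.pos_s3 x → x = w) :
    G.Path a c where
  verts := P.verts.take (P.pos_s3 w + 1) ++ Q.verts.drop (Q.pos_s3 w + 1)
  edges := P.edges.take (P.pos_s3 w) ++ Q.edges.drop (Q.pos_s3 w)
  nodup := by
    refine List.Nodup.append (P.nodup.sublist (List.take_sublist _ _))
      (Q.nodup.sublist (List.drop_sublist _ _)) fun x hx hx' => ?_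
    obtain ⟨h1, h2⟩ := (mem_take_iff_idxOf_lt _ _).1 hx
    obtain ⟨h3, h4⟩ := (mem_drop_iff_le_idxOf Q.nodup _ _).1 hx'
    have := hw x h1 (Nat.lt_succ_iff.1 h2) h3 (Nat.le_of_succ_le h4)
    subst this
    exact absurd h4 (by simp [pos_s3])
  length_eq := by
    have h1 := P.pos_lt_s3 hP
    have h2 := Q.pos_lt_s3 hQ
    have h3 := P.length_eq
    have h4 := Q.length_eq
    simp only [List.length_append, List.length_take, List.length_drop]
    omega
  head_eq := by
    have := P.head_eq
    rw [List.head?_append, List.head?_take, this]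
    simp
  last_eq := by
    have h1 := P.pos_lt_s3 hP
    have h2 := Q.pos_lt_s3 hQ
    have h3 := Q.last_eq
    rw [List.getLast?_append, List.getLast?_drop, List.getLast?_take]
    by_cases h : Q.verts.length ≤ Q.pos_s3 w + 1
    · rw [List.getLast?_eq_getElem?, List.getElem?_eq_getElem (by omega)] at h3
      have h4 : w = c := by
        rw [← Q.getElem_pos_s3 hQ]
        simp only [show Q.verts.length - 1 = Q.pos_s3 w by omega] at h3
        exact Option.some.inj h3
      rw [if_pos h, if_neg (Nat.succ_ne_zero _), Nat.add_sub_cancel, List.getElem?_eq_getElem h1,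
        P.getElem_pos_s3 hP, h4]
      simp
    · simp [h, h3]
  inc := by
    intro i h
    have h1 := P.pos_lt_s3 hP
    have h2 := Q.pos_lt_s3 hQ
    have h3 := P.length_eq
    have h4 := Q.length_eq
    simp only [List.length_append, List.length_take, List.length_drop] at h
    have hgP := P.getElem_pos_s3 hP
    have hgQ := Q.getElem_pos_s3 hQ
    rcases lt_trichotomy i (P.pos_s3 w) with hi | hi | hi
    · rw [List.getElem_append_left (by simp; omega), List.getElem_append_left (by simp; omega),
        List.getElem_append_left (by simp; omega)]
      simpa using P.inc i (by omega)
    · rw [List.getElem_append_right (by simp; omega), List.getElem_append_left (by simp; omega),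
        List.getElem_append_right (by simp; omega)]
      simp only [List.getElem_drop, List.getElem_take, List.length_take, hi, hgP]
      exact Q.inc_of_eq (by omega) (by omega) (by omega) (by omega) hgQ
    · rw [List.getElem_append_right (by simp; omega), List.getElem_append_right (by simp; omega),
        List.getElem_append_right (by simp; omega)]
      simp only [List.getElem_drop, List.length_take]
      exact Q.inc_of_eq (by omega) (by omega) (by omega) (by omega) rfl

theorem pair_sublist_iff_pos_lt (P : G.Path a b) (u v : V) :
    [u, v].Sublist P.verts ↔ u ∈ P.verts ∧ v ∈ P.verts ∧ P.pos_s3 u < P.pos_s3 v :=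
  pair_sublist_iff P.nodup u v

end Path

variable {a b c : V}

theorem OrderCompatible.pos_lt_iff {P Q : G.Path a b} (h : OrderCompatible P Q) {u v : V}
    (hu : u ∈ P.verts) (hv : v ∈ P.verts) (hu' : u ∈ Q.verts) (hv' : v ∈ Q.verts) :
    P.pos_s3 u < P.pos_s3 v ↔ Q.pos_s3 u < Q.pos_s3 v := by
  have := h u v hu hv hu' hv'
  rw [P.pair_sublist_iff_pos_lt, Q.pair_sublist_iff_pos_lt] at this
  tauto

/-- The segment of `P` up to `w` and the segment of `Q` from `z` on have no common vertex other
than `w`, or none other than `z`. -/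
def SegmentsMeetIn (P : G.Path a b) (w : V) (Q : G.Path b c) (z : V) : Prop :=
  (∀ x ∈ P.verts, P.pos_s3 x ≤ P.pos_s3 w → x ∈ Q.verts → Q.pos_s3 z ≤ Q.pos_s3 x → x = w) ∨
  (∀ x ∈ P.verts, P.pos_s3 x ≤ P.pos_s3 w → x ∈ Q.verts → Q.pos_s3 z ≤ Q.pos_s3 x → x = z)

theorem SegmentsMeetIn.eq_or_eq {P : G.Path a b} {w : V} {Q : G.Path b c} {z : V}
    (h : SegmentsMeetIn P w Q z) : ∀ x ∈ P.verts, P.pos_s3 x ≤ P.pos_s3 w → x ∈ Q.verts →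
      Q.pos_s3 z ≤ Q.pos_s3 x → x = w ∨ x = z := by
  rcases h with h | h
  · exact fun x h1 h2 h3 h4 => Or.inl (h x h1 h2 h3 h4)
  · exact fun x h1 h2 h3 h4 => Or.inr (h x h1 h2 h3 h4)

theorem SegmentsMeetIn.not_mem_edges {P : G.Path a b} {w : V} {Q : G.Path b c} {z : V}
    (h : SegmentsMeetIn P w Q z) (e : E) (he : e ∈ P.edges.take (P.pos_s3 w)) :
    e ∉ Q.edges.drop (Q.pos_s3 z) := by
  intro he'
  have h1 := P.mem_ends_of_mem_take he
  have h2 := Q.mem_ends_of_mem_drop he'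
  refine G.not_loop e ?_
  have key : ∃ y, ∀ x ∈ G.ends e, x = y := by
    rcases h with h | h
    · exact ⟨w, fun x hx => h x (h1 x hx).1 (h1 x hx).2 (h2 x hx).1 (h2 x hx).2⟩
    · exact ⟨z, fun x hx => h x (h1 x hx).1 (h1 x hx).2 (h2 x hx).1 (h2 x hx).2⟩
  obtain ⟨y, hy⟩ := key
  generalize G.ends e = s at hy
  induction s with
  | _ p q => simp [hy p, hy q]

/-- The ways in which one vertex can precede another on a spliced path. -/
theorem Path.splice_cases {P : G.Path a b} {Q : G.Path b c} {w : V} {hP : w ∈ P.verts}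
    {hQ : w ∈ Q.verts} {hw} {u v : V}
    (h : [u, v].Sublist (P.splice Q w hP hQ hw).verts) :
    (u ∈ P.verts ∧ v ∈ P.verts ∧ P.pos_s3 u < P.pos_s3 v ∧ P.pos_s3 v ≤ P.pos_s3 w) ∨
    (u ∈ P.verts ∧ P.pos_s3 u ≤ P.pos_s3 w ∧ v ∈ Q.verts ∧ Q.pos_s3 w < Q.pos_s3 v) ∨
    (u ∈ Q.verts ∧ v ∈ Q.verts ∧ Q.pos_s3 w < Q.pos_s3 u ∧ Q.pos_s3 u < Q.pos_s3 v) := by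
  have hT : ∀ {x}, x ∈ P.verts.take (P.pos_s3 w + 1) → x ∈ P.verts ∧ P.pos_s3 x ≤ P.pos_s3 w :=
    fun hx => ((mem_take_iff_idxOf_lt _ _).1 hx).imp_right Nat.lt_succ_iff.1
  have hD : ∀ {x}, x ∈ Q.verts.drop (Q.pos_s3 w + 1) → x ∈ Q.verts ∧ Q.pos_s3 w < Q.pos_s3 x :=
    fun hx => (mem_drop_iff_le_idxOf Q.nodup _ _).1 hx
  obtain ⟨l₁, l₂, hl, h₁, h₂⟩ := List.sublist_append_iff.1 h
  match l₁, hl with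
  | [], hl =>
    obtain rfl : [u, v] = l₂ := hl
    have h3 := (Q.pair_sublist_iff_pos_lt u v).1 (h₂.trans (List.drop_sublist _ _))
    exact Or.inr (Or.inr ⟨h3.1, h3.2.1, (hD (h₂.subset (by simp))).2, h3.2.2⟩)
  | [x], hl =>
    obtain ⟨rfl, rfl⟩ : u = x ∧ [v] = l₂ := by simpa using hl
    have h3 := hT (List.singleton_sublist.1 h₁)
    have h4 := hD (List.singleton_sublist.1 h₂)
    exact Or.inr (Or.inl ⟨h3.1, h3.2, h4.1, h4.2⟩)
  | x :: y :: l, hl =>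
    obtain ⟨rfl, rfl, rfl, rfl⟩ : u = x ∧ v = y ∧ l = [] ∧ l₂ = [] := by simpa using hl
    have h3 := (P.pair_sublist_iff_pos_lt u v).1 (h₁.trans (List.take_sublist _ _))
    exact Or.inl ⟨h3.1, h3.2.1, h3.2.2, (hT (h₁.subset (by simp))).2⟩

theorem Path.not_sublist_swap_splice {P P' : G.Path a b} {Q Q' : G.Path b c} {w w' : V}
    {hP : w ∈ P.verts} {hQ : w ∈ Q.verts} {hw} {hP' : w' ∈ P'.verts} {hQ' : w' ∈ Q'.verts} {hw'}
    (hPP : OrderCompatible P P') (hQQ : OrderCompatible Q Q')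
    (h₁ : SegmentsMeetIn P w Q' w') (h₂ : SegmentsMeetIn P' w' Q w) {u v : V}
    (h : [u, v].Sublist (P.splice Q w hP hQ hw).verts) :
    ¬ [v, u].Sublist (P'.splice Q' w' hP' hQ' hw').verts := by
  intro h'
  have p1 := hPP.pos_lt_iff (u := u) (v := v)
  have p2 := hPP.pos_lt_iff (u := v) (v := u)
  have q1 := hQQ.pos_lt_iff (u := u) (v := v)
  have q2 := hQQ.pos_lt_iff (u := v) (v := u)
  have k1 := h₁.eq_or_eq u
  have k2 := h₁.eq_or_eq v
  have k3 := h₂.eq_or_eq u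
  have k4 := h₂.eq_or_eq v
  rcases Path.splice_cases h with h | h | h <;> rcases Path.splice_cases h' with h' | h' | h' <;>
    clear * - h h' p1 p2 q1 q2 k1 k2 k3 k4 hP hQ hP' hQ' <;> grind

theorem splice_orderCompatible {P P' : G.Path a b} {Q Q' : G.Path b c} {w w' : V}
    {hP : w ∈ P.verts} {hQ : w ∈ Q.verts} {hw} {hP' : w' ∈ P'.verts} {hQ' : w' ∈ Q'.verts} {hw'}
    (hPP : OrderCompatible P P') (hQQ : OrderCompatible Q Q')
    (h₁ : SegmentsMeetIn P w Q' w') (h₂ : SegmentsMeetIn P' w' Q w) :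
    OrderCompatible (P.splice Q w hP hQ hw) (P'.splice Q' w' hP' hQ' hw') := by
  intro u v hu hv hu' hv'
  have h3 := Path.not_sublist_swap_splice (hP := hP) (hQ := hQ) (hw := hw) (hP' := hP')
    (hQ' := hQ') (hw' := hw') hPP hQQ h₁ h₂ (u := u) (v := v)
  have h4 := Path.not_sublist_swap_splice (hP := hP) (hQ := hQ) (hw := hw) (hP' := hP')
    (hQ' := hQ') (hw' := hw') hPP hQQ h₁ h₂ (u := v) (v := u)
  generalize P.splice Q w hP hQ hw = R at *
  generalize P'.splice Q' w' hP' hQ' hw' = R' at *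
  simp only [Path.pair_sublist_iff_pos_lt] at *
  have h5 := R.eq_of_pos_eq_s3 (y := v) hu
  have h6 := R'.eq_of_pos_eq_s3 (y := v) hu'
  grind

theorem splice_edgeDisjoint {P P' : G.Path a b} {Q Q' : G.Path b c} {w w' : V}
    {hP : w ∈ P.verts} {hQ : w ∈ Q.verts} {hw} {hP' : w' ∈ P'.verts} {hQ' : w' ∈ Q'.verts} {hw'}
    (hPP : EdgeDisjoint P P') (hQQ : EdgeDisjoint Q Q')
    (h₁ : SegmentsMeetIn P w Q' w') (h₂ : SegmentsMeetIn P' w' Q w) :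
    EdgeDisjoint (P.splice Q w hP hQ hw) (P'.splice Q' w' hP' hQ' hw') := by
  intro e he hf
  rcases List.mem_append.1 he with he | he <;> rcases List.mem_append.1 hf with hf | hf
  · exact hPP e (List.mem_of_mem_take he) (List.mem_of_mem_take hf)
  · exact h₁.not_mem_edges e he hf
  · exact h₂.not_mem_edges e hf he
  · exact hQQ e (List.mem_of_mem_drop he) (List.mem_of_mem_drop hf)

/-- Indices of a path of each of two families, and a vertex at which to switch between them. -/
structure Switch (V : Type u) : Type u where
  fst : ℕ
  snd : ℕ
  vertex : V

/-- The switch `t` describes a path from `a` to `c`. -/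
def Switch.Valid (P : ℕ → G.Path a b) (Q : ℕ → G.Path b c) (t : Switch V) : Prop :=
  t.vertex ∈ (P t.fst).verts ∧ t.vertex ∈ (Q t.snd).verts ∧
    SegmentsMeetIn (P t.fst) t.vertex (Q t.snd) t.vertex

/-- The paths described by the switches `s` and `t` do not interfere with each other. -/
def Switch.Compatible (P : ℕ → G.Path a b) (Q : ℕ → G.Path b c) (s t : Switch V) : Prop :=
  s.fst ≠ t.fst ∧ s.snd ≠ t.snd ∧ SegmentsMeetIn (P s.fst) s.vertex (Q t.snd) t.vertex ∧
    SegmentsMeetIn (P t.fst) t.vertex (Q s.snd) s.vertex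

theorem Switch.Compatible.symm {P : ℕ → G.Path a b} {Q : ℕ → G.Path b c} {s t : Switch V}
    (h : s.Compatible P Q t) : t.Compatible P Q s :=
  ⟨h.1.symm, h.2.1.symm, h.2.2.2, h.2.2.1⟩

theorem exists_family_of_switches (hac : a ≠ c) {P : ℕ → G.Path a b} {Q : ℕ → G.Path b c}
    (hPd : Pairwise fun i j => EdgeDisjoint (P i) (P j))
    (hPo : Pairwise fun i j => OrderCompatible (P i) (P j))
    (hQd : Pairwise fun i j => EdgeDisjoint (Q i) (Q j))
    (hQo : Pairwise fun i j => OrderCompatible (Q i) (Q j))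
    (p : Switch V → Prop) (hp : ∀ t, p t → t.Valid P Q)
    (hext : ∀ s : Finset (Switch V), (∀ t ∈ s, p t) →
      ∃ t', p t' ∧ ∀ t ∈ s, t.Compatible P Q t') :
    ∃ R : Set (G.Path a c), R.Countable ∧ R.Infinite ∧ R.Pairwise EdgeDisjoint ∧
      R.Pairwise OrderCompatible := by
  have : Std.Symm (Switch.Compatible P Q) := ⟨fun _ _ h => h.symm⟩
  obtain ⟨f, hf, hc⟩ := exists_seq_of_forall_finset_exists' p (Switch.Compatible P Q) hext
  have hv := fun n => hp _ (hf n)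
  let R : ℕ → G.Path a c := fun n =>
    (P (f n).fst).splice (Q (f n).snd) (f n).vertex (hv n).1 (hv n).2.1
      fun x h1 h2 h3 h4 => or_self_iff.1 ((hv n).2.2.eq_or_eq x h1 h2 h3 h4)
  have hd : ∀ m n, m ≠ n → EdgeDisjoint (R m) (R n) := fun m n hmn =>
    have h := hc hmn
    splice_edgeDisjoint (hPd h.1) (hQd h.2.1) h.2.2.1 h.2.2.2
  have ho : ∀ m n, m ≠ n → OrderCompatible (R m) (R n) := fun m n hmn =>
    have h := hc hmn
    splice_orderCompatible (hPo h.1) (hQo h.2.1) h.2.2.1 h.2.2.2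
  have hinj : Function.Injective R := by
    intro m n hmn
    by_contra hne
    obtain ⟨e, he⟩ := (R m).exists_edge hac
    exact hd m n hne e he (hmn ▸ he)
  refine ⟨Set.range R, Set.countable_range R, Set.infinite_range_of_injective hinj, ?_, ?_⟩
  · rintro _ ⟨m, rfl⟩ _ ⟨n, rfl⟩ hne
    exact hd m n fun h => hne (h ▸ rfl)
  · rintro _ ⟨m, rfl⟩ _ ⟨n, rfl⟩ hne
    exact ho m n fun h => hne (h ▸ rfl)

/-- The vertex `x` lies on almost all paths of the sequence, with respect to a fixed
nonprincipal ultrafilter. -/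
def IsLimit (P : ℕ → G.Path a b) (x : V) : Prop :=
  ∀ᶠ i in (hyperfilter ℕ : Filter ℕ), x ∈ (P i).verts

theorem eventually_isLimit_of_mem (P : ℕ → G.Path a b) {s : Set V} (hs : s.Finite) :
    ∀ᶠ i in (hyperfilter ℕ : Filter ℕ), ∀ x ∈ s, x ∈ (P i).verts → IsLimit P x := by
  refine (eventually_all_finite hs).2 fun x _ => ?_
  by_cases h : IsLimit P x
  · exact Eventually.of_forall fun _ _ => h
  · exact (Ultrafilter.eventually_not.2 h).mono fun _ h1 h2 => absurd h2 h1

theorem eventually_not_mem_finset (s : Finset ℕ) :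
    ∀ᶠ i in (hyperfilter ℕ : Filter ℕ), i ∉ s :=
  s.finite_toSet.compl_mem_hyperfilter

theorem finite_verts (P : G.Path a b) : {x | x ∈ P.verts}.Finite := P.verts.finite_toSet

/-- The vertex `x` is a limit vertex of `P` up to which almost all paths `P i` avoid the limit
vertices of `Q`. -/
def IsEarly (P : ℕ → G.Path a b) (Q : ℕ → G.Path b c) (x : V) : Prop :=
  IsLimit P x ∧ ∀ᶠ i in (hyperfilter ℕ : Filter ℕ),
    ∀ y ∈ (P i).verts, (P i).pos_s3 y ≤ (P i).pos_s3 x → ¬ IsLimit Q y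

theorem IsEarly.of_pos_le {P : ℕ → G.Path a b} {Q : ℕ → G.Path b c}
    (hPo : Pairwise fun i j => OrderCompatible (P i) (P j)) {w x : V} (hw : IsEarly P Q w)
    (hx : IsLimit P x) {i : ℕ} (hwi : w ∈ (P i).verts) (hxi : x ∈ (P i).verts)
    (hle : (P i).pos_s3 x ≤ (P i).pos_s3 w) : IsEarly P Q x := by
  refine ⟨hx, ?_⟩
  filter_upwards [hx, hw.1, hw.2, eventually_not_mem_finset {i}] with k hxk hwk h hki y hy hyx
  have hik : i ≠ k := fun h => hki (by simp [h])
  have := (hPo hik).pos_lt_iff hwi hxi hwk hxk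
  exact h y hy (by omega)

/-- If almost all `Q j` avoid the early vertices, one can switch from `P i` at the first vertex
that it has in common with any of those `Q j`. -/
theorem exists_family_of_eventually_not_isEarly (hac : a ≠ c) {P : ℕ → G.Path a b}
    {Q : ℕ → G.Path b c}
    (hPd : Pairwise fun i j => EdgeDisjoint (P i) (P j))
    (hPo : Pairwise fun i j => OrderCompatible (P i) (P j))
    (hQd : Pairwise fun i j => EdgeDisjoint (Q i) (Q j))
    (hQo : Pairwise fun i j => OrderCompatible (Q i) (Q j))
    (hT : ∀ᶠ j in (hyperfilter ℕ : Filter ℕ), ∀ x ∈ (Q j).verts, ¬ IsEarly P Q x) :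
    ∃ R : Set (G.Path a c), R.Countable ∧ R.Infinite ∧ R.Pairwise EdgeDisjoint ∧
      R.Pairwise OrderCompatible := by
  set T : Set ℕ := {j | ∀ x ∈ (Q j).verts, ¬ IsEarly P Q x}
  have hy : ∀ i, ∃ y ∈ (P i).verts, (∃ j ∈ T, y ∈ (Q j).verts) ∧
      ∀ x ∈ (P i).verts, (∃ j ∈ T, x ∈ (Q j).verts) → (P i).pos_s3 y ≤ (P i).pos_s3 x := by
    intro i
    obtain ⟨j, hj⟩ := hT.exists
    obtain ⟨y, hy, hmin⟩ := Set.exists_min_image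
      {x | x ∈ (P i).verts ∧ ∃ j ∈ T, x ∈ (Q j).verts} (P i).pos_s3
      ((finite_verts (P i)).subset fun x hx => hx.1)
      ⟨b, (P i).end_mem_s3, j, hj, (Q j).start_mem_s3⟩
    exact ⟨y, hy.1, hy.2, fun x hx hx' => hmin x ⟨hx, hx'⟩⟩
  choose y hyP hyT hymin using hy
  refine exists_family_of_switches hac hPd hPo hQd hQo
    (fun t => t.snd ∈ T ∧ t.vertex = y t.fst ∧ t.vertex ∈ (Q t.snd).verts) ?_ ?_
  · rintro ⟨i, j, w⟩ ⟨hj, hw, hyj⟩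
    obtain rfl : w = y i := hw
    refine ⟨hyP i, hyj, Or.inl fun x hx hle hxQ _ => ?_⟩
    exact (P i).eq_of_pos_eq_s3 hx (hle.antisymm (hymin i x hx ⟨j, hj, hxQ⟩))
  intro s hs
  suffices h : ∃ i, i ∉ s.image Switch.fst ∧ ∃ j ∈ T, j ∉ s.image Switch.snd ∧
      y i ∈ (Q j).verts by
    obtain ⟨i, hi, j, hjT, hj, hyj⟩ := h
    refine ⟨⟨i, j, y i⟩, ⟨hjT, rfl, hyj⟩, ?_⟩
    rintro ⟨i', j', y'⟩ ht
    obtain ⟨hj', hy, hy'⟩ := hs _ ht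
    obtain rfl : y' = y i' := hy
    refine ⟨fun h => hi (Finset.mem_image.2 ⟨_, ht, h⟩),
      fun h => hj (Finset.mem_image.2 ⟨_, ht, h⟩), Or.inl fun x hx hle hxQ _ => ?_,
      Or.inl fun x hx hle hxQ _ => ?_⟩
    · exact (P i').eq_of_pos_eq_s3 hx (hle.antisymm (hymin i' x hx ⟨j, hjT, hxQ⟩))
    · exact (P i).eq_of_pos_eq_s3 hx (hle.antisymm (hymin i x hx ⟨j', hj', hxQ⟩))
  by_contra! hno
  set B : Set V := ⋃ j ∈ s.image Switch.snd, {x | x ∈ (Q j).verts}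
  have hBfin : B.Finite := Set.Finite.biUnion (Finset.finite_toSet _) fun j _ => finite_verts (Q j)
  have hyB : ∀ᶠ i in (hyperfilter ℕ : Filter ℕ), y i ∈ B := by
    filter_upwards [eventually_not_mem_finset (s.image Switch.fst)] with i hi
    obtain ⟨j, hjT, hyj⟩ := hyT i
    have hj : j ∈ s.image Switch.snd := by
      by_contra hj
      exact hno i hi j hjT hj hyj
    exact Set.mem_biUnion hj hyj
  obtain ⟨z, -, hz⟩ : ∃ z ∈ B, ∀ᶠ i in (hyperfilter ℕ : Filter ℕ), y i = z := by
    have : (⋃ z ∈ B, {i | y i = z}) ∈ hyperfilter ℕ := by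
      refine mem_of_superset hyB fun i hi => Set.mem_biUnion hi ?_
      exact rfl
    exact (Ultrafilter.finite_biUnion_mem_iff hBfin).1 this
  have hzE : IsEarly P Q z := by
    refine ⟨hz.mono fun i hi => hi ▸ hyP i, ?_⟩
    filter_upwards [hz, eventually_not_mem_finset (s.image Switch.fst)] with i hi his x hx hle hxQ
    obtain ⟨j, hxj, hjT, hjs⟩ :=
      (hxQ.and (hT.and (eventually_not_mem_finset (s.image Switch.snd)))).exists
    have hxy : x = y i :=
      (P i).eq_of_pos_eq_s3 hx (le_antisymm (hi ▸ hle) (hymin i x hx ⟨j, hjT, hxj⟩))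
    exact hno i his j hjT hjs (hxy ▸ hxj)
  obtain ⟨i, rfl⟩ := hz.exists
  obtain ⟨j, hjT, hyj⟩ := hyT i
  exact hjT _ hyj hzE

/-- If almost all `Q j` contain an early vertex, one can switch to `Q j` at the last of them. -/
theorem exists_family_of_eventually_isEarly (hac : a ≠ c) {P : ℕ → G.Path a b}
    {Q : ℕ → G.Path b c}
    (hPd : Pairwise fun i j => EdgeDisjoint (P i) (P j))
    (hPo : Pairwise fun i j => OrderCompatible (P i) (P j))
    (hQd : Pairwise fun i j => EdgeDisjoint (Q i) (Q j))
    (hQo : Pairwise fun i j => OrderCompatible (Q i) (Q j))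
    (hT : ∀ᶠ j in (hyperfilter ℕ : Filter ℕ), ∃ x ∈ (Q j).verts, IsEarly P Q x) :
    ∃ R : Set (G.Path a c), R.Countable ∧ R.Infinite ∧ R.Pairwise EdgeDisjoint ∧
      R.Pairwise OrderCompatible := by
  refine exists_family_of_switches hac hPd hPo hQd hQo
    (fun t => t.Valid P Q ∧
      (∀ x ∈ (P t.fst).verts, (P t.fst).pos_s3 x ≤ (P t.fst).pos_s3 t.vertex → ¬ IsLimit Q x) ∧
      (∀ x ∈ (Q t.snd).verts, IsEarly P Q x → (Q t.snd).pos_s3 x ≤ (Q t.snd).pos_s3 t.vertex))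
    (fun t ht => ht.1) ?_
  intro s hs
  obtain ⟨j, hjE, hjs, hjP⟩ := (hT.and ((eventually_not_mem_finset (s.image Switch.snd)).and
    (eventually_isLimit_of_mem Q (Set.Finite.biUnion s.finite_toSet
      fun t _ => finite_verts (P t.fst))))).exists
  obtain ⟨w, ⟨hwQ, hwE⟩, hmax⟩ := Set.exists_max_image
    {x | x ∈ (Q j).verts ∧ IsEarly P Q x} (Q j).pos_s3
    ((finite_verts (Q j)).subset fun x hx => hx.1) hjE
  obtain ⟨i, his, hwP, hav, hiQ, hiQs⟩ := ((eventually_not_mem_finset (s.image Switch.fst)).and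
    (hwE.1.and (hwE.2.and ((eventually_isLimit_of_mem P (finite_verts (Q j))).and
      (eventually_isLimit_of_mem P (Set.Finite.biUnion s.finite_toSet
        fun t _ => finite_verts (Q t.snd))))))).exists
  refine ⟨⟨i, j, w⟩, ⟨⟨hwP, hwQ, Or.inl fun x hx hle hxQ hge => ?_⟩, hav,
    fun x hx hxE => hmax x ⟨hx, hxE⟩⟩, fun t ht => ?_⟩
  · have hxE := hwE.of_pos_le hPo (hiQ x hxQ hx) hwP hx hle
    exact (Q j).eq_of_pos_eq_s3 hxQ ((hmax x ⟨hxQ, hxE⟩).antisymm hge)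
  · obtain ⟨-, htav, htmax⟩ := hs t ht
    refine ⟨fun h => his (Finset.mem_image.2 ⟨_, ht, h⟩),
      fun h => hjs (Finset.mem_image.2 ⟨_, ht, h⟩), Or.inl fun x hx hle hxQ _ => ?_,
      Or.inr fun x hx hle hxQ hge => ?_⟩
    · exact absurd (hjP x (Set.mem_biUnion ht hx) hxQ) (htav x hx hle)
    · have hxE := hwE.of_pos_le hPo (hiQs x (Set.mem_biUnion ht hxQ) hx) hwP hx hle
      exact (Q t.snd).eq_of_pos_eq_s3 hxQ ((htmax x hxQ hxE).antisymm hge)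

end

end Multigraph

/-- **Transitivity, countable case.**  If distinct vertices `a, b, c` are such that there
is a countably infinite family of pairwise edge-disjoint, pairwise order-compatible
`a`–`b` paths and likewise for `b`–`c`, then there is such a family of `a`–`c` paths. -/
theorem transitive_countable {V E : Type u} (G : Multigraph V E) (a b c : V)
    (hab : a ≠ b) (hac : a ≠ c) (hbc : b ≠ c)
    (Pab : Set (G.Path a b)) (hPcount : Pab.Countable) (hPinf : Pab.Infinite)
    (hPdisj : Pab.Pairwise Multigraph.EdgeDisjoint)
    (hPoc : Pab.Pairwise Multigraph.OrderCompatible)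
    (Qbc : Set (G.Path b c)) (hQcount : Qbc.Countable) (hQinf : Qbc.Infinite)
    (hQdisj : Qbc.Pairwise Multigraph.EdgeDisjoint)
    (hQoc : Qbc.Pairwise Multigraph.OrderCompatible) :
    ∃ Rac : Set (G.Path a c), Rac.Countable ∧ Rac.Infinite ∧
      Rac.Pairwise Multigraph.EdgeDisjoint ∧ Rac.Pairwise Multigraph.OrderCompatible := by
  let P := fun n => (hPinf.natEmbedding Pab n : G.Path a b)
  let Q := fun n => (hQinf.natEmbedding Qbc n : G.Path b c)
  have hP : ∀ {i j : ℕ}, i ≠ j → P i ≠ P j := fun hij h =>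
    hij ((hPinf.natEmbedding Pab).injective (Subtype.ext h))
  have hQ : ∀ {i j : ℕ}, i ≠ j → Q i ≠ Q j := fun hij h =>
    hij ((hQinf.natEmbedding Qbc).injective (Subtype.ext h))
  have hPd : Pairwise fun i j => Multigraph.EdgeDisjoint (P i) (P j) := fun i j hij =>
    hPdisj (Subtype.prop _) (Subtype.prop _) (hP hij)
  have hPo : Pairwise fun i j => Multigraph.OrderCompatible (P i) (P j) := fun i j hij =>
    hPoc (Subtype.prop _) (Subtype.prop _) (hP hij)
  have hQd : Pairwise fun i j => Multigraph.EdgeDisjoint (Q i) (Q j) := fun i j hij =>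
    hQdisj (Subtype.prop _) (Subtype.prop _) (hQ hij)
  have hQo : Pairwise fun i j => Multigraph.OrderCompatible (Q i) (Q j) := fun i j hij =>
    hQoc (Subtype.prop _) (Subtype.prop _) (hQ hij)
  by_cases h : ∀ᶠ j in (Filter.hyperfilter ℕ : Filter ℕ),
      ∃ x ∈ (Q j).verts, Multigraph.IsEarly P Q x
  · exact Multigraph.exists_family_of_eventually_isEarly hac hPd hPo hQd hQo h
  · refine Multigraph.exists_family_of_eventually_not_isEarly hac hPd hPo hQd hQo ?_
    filter_upwards [Ultrafilter.eventually_not.2 h] with j hj x hx hxE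
    exact hj ⟨x, hx, hxE⟩
end

section
/- Let G be a graph (possibly with parallel edges), let k be a natural number, and let a, b be two vertices of G such that G contains k pairwise edge-disjoint a–b paths. Then G contains k pairwise edge-disjoint a–b paths that are pairwise order-compatible. -/
universe u

namespace Multigraph

variable {V E : Type u} {G : Multigraph V E} {a b c u v : V}

/-- `G.IsWalk a b l` says that `l` is the edge list of a walk from `a` to `b`. -/
inductive IsWalk (G : Multigraph V E) : V → V → List E → Prop
  | nil (a : V) : IsWalk G a a []
  | cons {a c b : V} {e : E} {l : List E} (h : G.ends e = s(a, c)) (hl : IsWalk G c b l) :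
      IsWalk G a b (e :: l)

theorem IsWalk.append {l m : List E} (hl : G.IsWalk a c l) (hm : G.IsWalk c b m) :
    G.IsWalk a b (l ++ m) := by
  induction hl with
  | nil => exact hm
  | cons h _ ih => exact .cons h (ih hm)

namespace Path

/-- The trivial path at `a`. -/
def single (G : Multigraph V E) (a : V) : G.Path a a where
  verts := [a]
  edges := []
  nodup := by simp
  length_eq := rfl
  head_eq := rfl
  last_eq := rfl
  inc i h := by simp at h

/-- Prepend an edge from a new vertex to a path. -/
def cons (P : G.Path c b) (e : E) (h : G.ends e = s(a, c)) (ha : a ∉ P.verts) :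
    G.Path a b where
  verts := a :: P.verts
  edges := e :: P.edges
  nodup := List.nodup_cons.2 ⟨ha, P.nodup⟩
  length_eq := by simp [P.length_eq]
  head_eq := rfl
  last_eq := by simp [List.getLast?_cons, P.last_eq]
  inc i hi := by
    cases i with
    | zero =>
      have := P.head_eq
      have h0 : 0 < P.verts.length := by simpa using hi
      rw [List.head?_eq_getElem?, List.getElem?_eq_getElem h0] at this
      simp_all
    | succ i => simpa using P.inc i (by simpa using hi)

/-- The final segment of a path starting at its vertex of index `i`. -/
def drop (P : G.Path a b) (i : ℕ) (hi : i < P.verts.length) : G.Path P.verts[i] b where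
  verts := P.verts.drop i
  edges := P.edges.drop i
  nodup := P.nodup.sublist (List.drop_sublist _ _)
  length_eq := by have := P.length_eq; simp only [List.length_drop]; omega
  head_eq := by simp [hi]
  last_eq := by rw [List.getLast?_drop, if_neg (by omega), P.last_eq]
  inc j hj := by
    simp only [List.length_drop] at hj
    simpa [add_assoc] using P.inc (i + j) (by omega)

theorem getElem_zero (P : G.Path a b) (h : 0 < P.verts.length) : P.verts[0] = a := by
  have := P.head_eq
  rwa [List.head?_eq_getElem?, List.getElem?_eq_getElem h, Option.some_inj] at this

theorem getElem_length_edges (P : G.Path a b) (h : P.edges.length < P.verts.length) :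
    P.verts[P.edges.length] = b := by
  have := P.last_eq
  have hl := P.length_eq
  rw [List.getLast?_eq_getElem?, hl, Nat.add_sub_cancel, List.getElem?_eq_getElem h,
    Option.some_inj] at this
  exact this

theorem nodup_edges (P : G.Path a b) : P.edges.Nodup := by
  have hl := P.length_eq
  rw [List.nodup_iff_injective_getElem]
  rintro ⟨i, hi⟩ ⟨j, hj⟩ h
  have h : P.edges[i] = P.edges[j] := h
  have h2 := congrArg G.ends h
  rw [P.inc i (by omega), P.inc j (by omega)] at h2
  simp only [Sym2.eq_iff, P.nodup.getElem_inj_iff] at h2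
  exact Fin.ext (by grind)

theorem isWalk_segment (P : G.Path a b) (n i : ℕ) (h : i + n < P.verts.length) :
    G.IsWalk P.verts[i] P.verts[i + n] ((P.edges.drop i).take n) := by
  have hl := P.length_eq
  induction n generalizing i with
  | zero => simpa using IsWalk.nil _
  | succ n ih =>
    rw [List.drop_eq_getElem_cons (by omega), List.take_succ_cons]
    refine .cons (P.inc i (by omega)) ?_
    have := ih (i + 1) (by omega)
    simpa only [add_assoc, add_comm 1 n] using this

/-- Two successive vertices of a path split it into three walks. -/
theorem exists_split (P : G.Path a b) (h : [u, v].Sublist P.verts) :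
    ∃ l₁ l₂ l₃ : List E, P.edges = l₁ ++ l₂ ++ l₃ ∧ l₂ ≠ [] ∧
      G.IsWalk a u l₁ ∧ G.IsWalk v b l₃ := by
  have hl := P.length_eq
  obtain ⟨f, hf⟩ := List.sublist_iff_exists_orderEmbedding_getElem?_eq.1 h
  obtain ⟨hi, hu⟩ := List.getElem?_eq_some_iff.1 (hf 0).symm
  obtain ⟨hj, hv⟩ := List.getElem?_eq_some_iff.1 (hf 1).symm
  have hij : f 0 < f 1 := f.lt_iff_lt.2 zero_lt_one
  generalize f 0 = i at *
  generalize f 1 = j at *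
  refine ⟨P.edges.take i, (P.edges.drop i).take (j - i), P.edges.drop j, ?_, ?_, ?_, ?_⟩
  · rw [List.append_assoc]
    have : P.edges.drop j = (P.edges.drop i).drop (j - i) := by
      rw [List.drop_drop]; congr 1; omega
    rw [this, List.take_append_drop, List.take_append_drop]
  · rw [← List.length_pos_iff, List.length_take, List.length_drop]; omega
  · have := P.isWalk_segment i 0 (by omega)
    simpa [hu, P.getElem_zero] using this
  · have := P.isWalk_segment (P.edges.length - j) j (by omega)
    have e : j + (P.edges.length - j) = P.edges.length := by omega
    rw [List.take_of_length_le (by simp)] at this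
    simpa only [e, P.getElem_length_edges, hv] using this

end Path

theorem IsWalk.exists_path {l : List E} (hl : G.IsWalk a b l) :
    ∃ P : G.Path a b, P.edges ⊆ l ∧ P.length ≤ l.length := by
  induction hl with
  | nil a => exact ⟨.single G a, by simp [Path.single], by simp [Path.single, Path.length]⟩
  | @cons a c b e l h _ ih =>
    obtain ⟨P, hP, hlen⟩ := ih
    unfold Path.length at hlen
    by_cases ha : a ∈ P.verts
    · obtain ⟨i, hi, rfl⟩ := List.getElem_of_mem ha
      refine ⟨P.drop i hi, fun x hx => List.mem_cons_of_mem _ (hP (List.mem_of_mem_drop hx)), ?_⟩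
      simp only [Path.drop, Path.length, List.length_drop, List.length_cons]
      omega
    · refine ⟨P.cons e h ha, List.cons_subset_cons _ hP, ?_⟩
      simpa [Path.cons, Path.length] using hlen

theorem EdgeDisjoint.symm {a' b' : V} {P : G.Path a b} {Q : G.Path a' b'}
    (h : EdgeDisjoint P Q) : EdgeDisjoint Q P :=
  fun e hQ hP => h e hP hQ

theorem sublist_pair_or_of_mem {α : Type*} {x y : α} {l : List α} (hx : x ∈ l) (hy : y ∈ l)
    (hxy : x ≠ y) : [x, y].Sublist l ∨ [y, x].Sublist l := by
  induction l with
  | nil => simp at hx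
  | cons z l ih => grind

theorem exists_reversed_pair {a' b' : V} {P : G.Path a b} {Q : G.Path a' b'}
    (h : ¬ OrderCompatible P Q) :
    ∃ u v, [u, v].Sublist P.verts ∧ [v, u].Sublist Q.verts := by
  unfold OrderCompatible at h
  push Not at h
  obtain ⟨u, v, huP, hvP, huQ, hvQ, ⟨h₁, h₂⟩ | ⟨h₁, h₂⟩⟩ := h
  · have huv : u ≠ v := by
      rintro rfl
      simpa using P.nodup.sublist h₁
    exact ⟨u, v, h₁, (sublist_pair_or_of_mem huQ hvQ huv).resolve_left h₂⟩
  · have huv : u ≠ v := by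
      rintro rfl
      simpa using Q.nodup.sublist h₂
    exact ⟨v, u, (sublist_pair_or_of_mem huP hvP huv).resolve_left h₁, h₂⟩

/-- Two edge-disjoint paths that are not order-compatible can be rerouted, within their union,
to edge-disjoint paths of smaller total length. -/
theorem EdgeDisjoint.exists_shorter {P Q : G.Path a b} (hPQ : EdgeDisjoint P Q)
    (h : ¬ OrderCompatible P Q) :
    ∃ P' Q' : G.Path a b, EdgeDisjoint P' Q' ∧ P'.edges ⊆ P.edges ++ Q.edges ∧
      Q'.edges ⊆ P.edges ++ Q.edges ∧ P'.length + Q'.length < P.length + Q.length := by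
  obtain ⟨u, v, hP, hQ⟩ := exists_reversed_pair h
  obtain ⟨l₁, l₂, l₃, hl, hl₂, hl₁w, hl₃w⟩ := P.exists_split hP
  obtain ⟨m₁, m₂, m₃, hm, -, hm₁w, hm₃w⟩ := Q.exists_split hQ
  obtain ⟨P', hP', hP'l⟩ := (hl₁w.append hm₃w).exists_path
  obtain ⟨Q', hQ', hQ'l⟩ := (hm₁w.append hl₃w).exists_path
  have hPn := P.nodup_edges
  have hQn := Q.nodup_edges
  have hl₂' := List.length_pos_iff.2 hl₂
  unfold EdgeDisjoint at hPQ
  simp only [hl, hm, Path.length, List.length_append] at *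
  refine ⟨P', Q', fun e hp hq => ?_, fun e he => ?_, fun e he => ?_, by omega⟩
  · have hp' := hP' hp
    have hq' := hQ' hq
    have := hPQ e
    simp only [List.nodup_append, List.mem_append] at *
    grind
  · have := hP' he
    simp only [List.mem_append] at *
    tauto
  · have := hQ' he
    simp only [List.mem_append] at *
    tauto

/-- An edge-disjoint family that is not pairwise order-compatible can be replaced by an
edge-disjoint family of smaller total length. -/
theorem exists_family_shorter {ι : Type*} [Fintype ι] {P : ι → G.Path a b}
    (hP : Pairwise fun i j => EdgeDisjoint (P i) (P j))
    (h : ¬ Pairwise fun i j => OrderCompatible (P i) (P j)) :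
    ∃ Q : ι → G.Path a b, (Pairwise fun i j => EdgeDisjoint (Q i) (Q j)) ∧
      ∑ i, (Q i).length < ∑ i, (P i).length := by
  classical
  unfold Pairwise at h
  push Not at h
  obtain ⟨i, j, hij, h⟩ := h
  obtain ⟨R, S, hRS, hR, hS, hlen⟩ := (hP hij).exists_shorter h
  let Q : ι → G.Path a b := fun x => if x = i then R else if x = j then S else P x
  have hQi : Q i = R := by simp [Q]
  have hQj : Q j = S := by simp [Q, hij.symm]
  have hQ {x : ι} (hi : x ≠ i) (hj : x ≠ j) : Q x = P x := by simp [Q, hi, hj]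
  have hdisj {T : G.Path a b} (hT : T.edges ⊆ (P i).edges ++ (P j).edges) {x : ι}
      (hi : x ≠ i) (hj : x ≠ j) : EdgeDisjoint T (P x) := fun e he hx =>
    (List.mem_append.1 (hT he)).elim (hP hi e hx) (hP hj e hx)
  refine ⟨Q, fun x y hxy => ?_, ?_⟩
  · rcases eq_or_ne x i with rfl | hxi
    · rcases eq_or_ne y j with rfl | hyj
      · rwa [hQi, hQj]
      · rw [hQi, hQ hxy.symm hyj]
        exact hdisj hR hxy.symm hyj
    rcases eq_or_ne x j with rfl | hxj
    · rcases eq_or_ne y i with rfl | hyi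
      · rw [hQi, hQj]
        exact hRS.symm
      · rw [hQj, hQ hyi hxy.symm]
        exact hdisj hS hyi hxy.symm
    rw [hQ hxi hxj]
    rcases eq_or_ne y i with rfl | hyi
    · rw [hQi]
      exact (hdisj hR hxi hxj).symm
    rcases eq_or_ne y j with rfl | hyj
    · rw [hQj]
      exact (hdisj hS hxi hxj).symm
    rw [hQ hyi hyj]
    exact hP hxy
  · have hj : j ∈ Finset.univ.erase i := by simp [hij.symm]
    rw [← Finset.add_sum_erase _ _ (Finset.mem_univ i), ← Finset.add_sum_erase _ _ hj,
      ← Finset.add_sum_erase _ (fun x => (P x).length) (Finset.mem_univ i),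
      ← Finset.add_sum_erase _ (fun x => (P x).length) hj, hQi, hQj]
    have : ∑ x ∈ (Finset.univ.erase i).erase j, (Q x).length =
        ∑ x ∈ (Finset.univ.erase i).erase j, (P x).length :=
      Finset.sum_congr rfl fun x hx => by
        simp only [Finset.mem_erase] at hx
        rw [hQ hx.2.1 hx.1]
    omega

end Multigraph

/-- **Dirac's question, finite case.**  If `a` and `b` are joined by `k` pairwise
edge-disjoint paths, then they are joined by `k` pairwise edge-disjoint, pairwise
order-compatible paths. -/
theorem dirac_finite {V E : Type u} (G : Multigraph V E) (k : ℕ) (a b : V)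
    (P : Fin k → G.Path a b)
    (hdisj : Pairwise fun i j => Multigraph.EdgeDisjoint (P i) (P j)) :
    ∃ Q : Fin k → G.Path a b,
      (Pairwise fun i j => Multigraph.EdgeDisjoint (Q i) (Q j)) ∧
      (Pairwise fun i j => Multigraph.OrderCompatible (Q i) (Q j)) := by
  induction hn : ∑ i, (P i).length using Nat.strong_induction_on generalizing P with
  | _ n ih =>
    by_cases h : Pairwise fun i j => Multigraph.OrderCompatible (P i) (P j)
    · exact ⟨P, hdisj, h⟩
    · obtain ⟨Q, hQ, hlt⟩ := Multigraph.exists_family_shorter hdisj h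
      exact ih _ (hn ▸ hlt) Q hQ rfl
end

section
/- Let G be a graph (possibly with parallel edges) and let a, b, c be distinct vertices of G. Let 𝒫_{a,b} be a countably infinite family of pairwise edge-disjoint, pairwise order-compatible a–b paths and 𝒫_{b,c} a countably infinite family of pairwise edge-disjoint, pairwise order-compatible b–c paths. Suppose 𝒫 ⊆ 𝒫_{a,b} and 𝒬 ⊆ 𝒫_{b,c} are infinite subfamilies that admit a (𝒫,𝒬)-terminal v, and that v belongs to infinitely many paths of 𝒫. Then G contains an infinite family of pairwise edge-disjoint, pairwise order-compatible a–c paths. -/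
universe u

/-- `v` is a `(𝒫,𝒬)`-terminal for a family `Pab` of `a`–`b` paths and a family `Qbc` of
`b`–`c` paths: `v` lies on some path of `Pab`, `v` lies on every path `Q ∈ Qbc`, and for
every `Q ∈ Qbc` the subpath of `Q` from `v` to `c` meets the union of the vertex sets of
the paths in `Pab` exactly in `{v}` (i.e. no vertex of `Q` strictly after `v` lies on a
path of `Pab`). -/
def Multigraph.IsTerminal {V E : Type u} {G : Multigraph V E} {a b c : V}
    (Pab : Set (G.Path a b)) (Qbc : Set (G.Path b c)) (v : V) : Prop :=
  (∃ P ∈ Pab, v ∈ P.verts) ∧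
    ∀ Q ∈ Qbc, v ∈ Q.verts ∧ ∀ x, [v, x].Sublist Q.verts → ∀ P ∈ Pab, x ∉ P.verts

theorem List.pair_sublist_append_iff {α : Type*} {x y : α} {l₁ l₂ : List α} :
    [x, y].Sublist (l₁ ++ l₂) ↔
      [x, y].Sublist l₁ ∨ (x ∈ l₁ ∧ y ∈ l₂) ∨ [x, y].Sublist l₂ := by
  induction l₁ with
  | nil => simp
  | cons z l ih =>
    simp only [List.cons_append, List.sublist_cons_iff, ih, List.mem_cons]
    simp
    grind

namespace Multigraph

variable {V E : Type u} {G : Multigraph V E}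

theorem Path.mem_verts_of_mem_ends {a b : V} (P : G.Path a b) {e : E} (he : e ∈ P.edges)
    {x : V} (hx : x ∈ G.ends e) : x ∈ P.verts := by
  obtain ⟨i, hi, rfl⟩ := List.mem_iff_getElem.1 he
  have hl := P.length_eq
  rw [P.inc i (by omega), Sym2.mem_iff] at hx
  rcases hx with rfl | rfl <;> exact List.getElem_mem _

/-- An edge traversed at or after the vertex `v` has an endpoint strictly after `v`. -/
theorem Path.exists_mem_ends_of_mem_drop {b c : V} (Q : G.Path b c) {v : V} {C D : List V}
    (hQ : Q.verts = C ++ v :: D) {e : E} (he : e ∈ Q.edges.drop C.length) :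
    ∃ x ∈ D, x ∈ G.ends e := by
  obtain ⟨i, hi, rfl⟩ := List.mem_iff_getElem.1 he
  have hl := Q.length_eq
  have hl' := congrArg List.length hQ
  simp only [List.length_append, List.length_cons, List.length_drop] at hi hl'
  have h := Q.inc (C.length + i) (by omega)
  have hx : Q.verts[C.length + i + 1]'(by omega) = D[i]'(by omega) := by
    simp only [hQ]
    grind
  refine ⟨D[i]'(by omega), List.getElem_mem _, ?_⟩
  rw [List.getElem_drop, h, hx]
  exact Sym2.mem_mk_right _ _

/-- Follow `P` up to `v` and then `Q` from `v` on. -/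
theorem Path.exists_splice {a b c d v : V} (P : G.Path a b) (Q : G.Path d c)
    {A B C D : List V} (hP : P.verts = A ++ v :: B) (hQ : Q.verts = C ++ v :: D)
    (hAD : List.Disjoint A D) :
    ∃ R : G.Path a c, R.verts = A ++ v :: D ∧
      R.edges = P.edges.take A.length ++ Q.edges.drop C.length := by
  have hPl := P.length_eq
  have hQl := Q.length_eq
  have hPn := P.nodup
  have hQn := Q.nodup
  have hPh := P.head_eq
  have hQh := Q.last_eq
  have hPi := P.inc
  have hQi := Q.inc
  have hPl' := congrArg List.length hP
  have hQl' := congrArg List.length hQ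
  simp only [List.length_append, List.length_cons] at hPl' hQl'
  refine ⟨⟨A ++ v :: D, P.edges.take A.length ++ Q.edges.drop C.length, ?_, ?_, ?_, ?_, ?_⟩,
    rfl, rfl⟩
  · rw [hP] at hPn
    rw [hQ] at hQn
    simp only [List.nodup_append, List.nodup_cons] at hPn hQn ⊢
    unfold List.Disjoint at hAD
    grind
  · simp
    omega
  · rw [hP] at hPh
    cases A <;> simpa using hPh
  · rw [hQ] at hQh
    simpa using hQh
  · intro i h
    simp only [List.length_append, List.length_cons] at h
    by_cases hi : i < A.length
    · have h1 := hPi i (by omega)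
      simp only [hP] at h1
      have e1 : (A ++ v :: B)[i]'(by simp; omega) = (A ++ v :: D)[i]'(by simp; omega) := by
        grind
      have e2 : (A ++ v :: B)[i + 1]'(by simp; omega) =
          (A ++ v :: D)[i + 1]'(by simp; omega) := by
        grind
      rw [e1, e2] at h1
      rw [← h1]
      congr 1
      grind
    · obtain ⟨j, rfl⟩ := Nat.exists_eq_add_of_le (not_lt.1 hi)
      have h1 := hQi (C.length + j) (by omega)
      simp only [hQ] at h1
      have e1 : (C ++ v :: D)[C.length + j]'(by simp; omega) =
          (A ++ v :: D)[A.length + j]'(by simp; omega) := by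
        rw [List.getElem_append_right (by omega), List.getElem_append_right (by omega)]
        simp
      have e2 : (C ++ v :: D)[C.length + j + 1]'(by simp; omega) =
          (A ++ v :: D)[A.length + j + 1]'(by simp; omega) := by
        rw [List.getElem_append_right (by omega), List.getElem_append_right (by omega)]
        simp [Nat.add_assoc]
      rw [e1, e2] at h1
      rw [← h1]
      have hlen : (P.edges.take A.length).length = A.length := by
        simp
        omega
      congr 1
      simp [List.getElem_append_right, hlen]

theorem Path.edges_ne_nil {a b : V} (hab : a ≠ b) (P : G.Path a b) : P.edges ≠ [] := by
  intro h
  have hl := P.length_eq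
  rw [h] at hl
  obtain ⟨x, hx⟩ := List.length_eq_one_iff.1 hl
  have h1 := P.head_eq
  have h2 := P.last_eq
  rw [hx] at h1 h2
  simp only [List.head?_cons, List.getLast?_singleton, Option.some.injEq] at h1 h2
  exact hab (h1.symm.trans h2)

end Multigraph

/-- **Lemma 3.2.**  If infinite subfamilies `P' ⊆ Pab` and `Q' ⊆ Qbc` admit a
`(P',Q')`-terminal `v` that belongs to infinitely many paths of `P'`, then `G` contains
an infinite family of pairwise edge-disjoint, pairwise order-compatible `a`–`c` paths. -/
theorem infinite_hitting {V E : Type u} (G : Multigraph V E) (a b c : V)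
    (hab : a ≠ b) (hac : a ≠ c) (hbc : b ≠ c)
    (Pab : Set (G.Path a b)) (hPcount : Pab.Countable) (hPinf : Pab.Infinite)
    (hPdisj : Pab.Pairwise Multigraph.EdgeDisjoint)
    (hPoc : Pab.Pairwise Multigraph.OrderCompatible)
    (Qbc : Set (G.Path b c)) (hQcount : Qbc.Countable) (hQinf : Qbc.Infinite)
    (hQdisj : Qbc.Pairwise Multigraph.EdgeDisjoint)
    (hQoc : Qbc.Pairwise Multigraph.OrderCompatible)
    (P' : Set (G.Path a b)) (hP'sub : P' ⊆ Pab) (hP'inf : P'.Infinite)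
    (Q' : Set (G.Path b c)) (hQ'sub : Q' ⊆ Qbc) (hQ'inf : Q'.Infinite)
    (v : V) (hterm : Multigraph.IsTerminal P' Q' v)
    (hhit : {P ∈ P' | v ∈ P.verts}.Infinite) :
    ∃ Rac : Set (G.Path a c), Rac.Infinite ∧
      Rac.Pairwise Multigraph.EdgeDisjoint ∧
      Rac.Pairwise Multigraph.OrderCompatible := by
  let P : ℕ → G.Path a b := fun n => hhit.natEmbedding _ n
  let Q : ℕ → G.Path b c := fun n => hQ'inf.natEmbedding _ n
  have hPmem : ∀ n, P n ∈ P' := fun n => (hhit.natEmbedding _ n).2.1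
  have hPv : ∀ n, v ∈ (P n).verts := fun n => (hhit.natEmbedding _ n).2.2
  have hQmem : ∀ n, Q n ∈ Q' := fun n => (hQ'inf.natEmbedding _ n).2
  have hPne : ∀ {m n}, m ≠ n → P m ≠ P n := fun h h' =>
    h ((hhit.natEmbedding _).injective (Subtype.ext h'))
  have hQne : ∀ {m n}, m ≠ n → Q m ≠ Q n := fun h h' =>
    h ((hQ'inf.natEmbedding _).injective (Subtype.ext h'))
  choose A B hAB using fun n => List.append_of_mem (hPv n)
  choose C D hCD using fun n => List.append_of_mem (hterm.2 (Q n) (hQmem n)).1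
  have hDP : ∀ m n, ∀ x ∈ D m, x ∉ (P n).verts := by
    intro m n x hx
    refine (hterm.2 (Q m) (hQmem m)).2 x ?_ (P n) (hPmem n)
    rw [hCD m, List.pair_sublist_append_iff]
    simp [hx]
  choose R hRv hRe using fun n => (P n).exists_splice (Q n) (hAB n) (hCD n)
    (fun x hx hx' => hDP n n x hx' (by simp [hAB, hx]))
  have hdisj : ∀ m n, m ≠ n → Multigraph.EdgeDisjoint (R m) (R n) := by
    have hcross : ∀ m n, ∀ e ∈ (Q m).edges.drop (C m).length, e ∉ (P n).edges := by
      intro m n e he he'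
      obtain ⟨x, hxD, hx⟩ := (Q m).exists_mem_ends_of_mem_drop (hCD m) he
      exact hDP m n x hxD ((P n).mem_verts_of_mem_ends he' hx)
    intro m n hmn e he he'
    rw [hRe, List.mem_append] at he he'
    rcases he with he | he <;> rcases he' with he' | he'
    · exact hPdisj (hP'sub (hPmem m)) (hP'sub (hPmem n)) (hPne hmn) e
        (List.mem_of_mem_take he) (List.mem_of_mem_take he')
    · exact hcross n m e he' (List.mem_of_mem_take he)
    · exact hcross m n e he (List.mem_of_mem_take he')
    · exact hQdisj (hQ'sub (hQmem m)) (hQ'sub (hQmem n)) (hQne hmn) e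
        (List.mem_of_mem_drop he) (List.mem_of_mem_drop he')
  have hoc : ∀ m n, m ≠ n → Multigraph.OrderCompatible (R m) (R n) := by
    intro m n hmn x y hxm hym hxn hyn
    have hP := hPoc (hP'sub (hPmem m)) (hP'sub (hPmem n)) (hPne hmn) x y
    have hQ := hQoc (hQ'sub (hQmem m)) (hQ'sub (hQmem n)) (hQne hmn) x y
    have h1 := hDP m m
    have h2 := hDP m n
    have h3 := hDP n m
    have h4 := hDP n n
    have n1 := (P m).nodup
    have n2 := (P n).nodup
    have n3 := (Q m).nodup
    have n4 := (Q n).nodup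
    have hsub : ∀ {l : List V}, [x, y].Sublist l → x ∈ l ∧ y ∈ l := fun h =>
      ⟨h.subset (by simp), h.subset (by simp)⟩
    have hA : ∀ k, (P k).verts = (A k ++ [v]) ++ B k := by simp [hAB]
    have hC : ∀ k, (Q k).verts = (C k ++ [v]) ++ D k := by simp [hCD]
    have hR : ∀ k, (R k).verts = (A k ++ [v]) ++ D k := by simp [hRv]
    simp only [hA, hC, hR] at *
    generalize A m ++ [v] = Am at *
    generalize A n ++ [v] = An at *
    generalize C m ++ [v] = Cm at *
    generalize C n ++ [v] = Cn at *
    generalize A m = A1, A n = A2, B m = B1, B n = B2, D m = D1, D n = D2 at *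
    clear * - hxm hym hxn hyn hP hQ h1 h2 h3 h4 n1 n2 n3 n4 hsub
    simp only [List.pair_sublist_append_iff, List.mem_append, List.nodup_append] at *
    have s1 := @hsub Am
    have s2 := @hsub An
    have s3 := @hsub D1
    have s4 := @hsub D2
    have s5 := @hsub B1
    have s6 := @hsub B2
    have s7 := @hsub Cm
    have s8 := @hsub Cn
    clear hsub
    grind
  have hinj : Function.Injective R := by
    intro m n h
    by_contra hmn
    obtain ⟨e, he⟩ := List.exists_mem_of_ne_nil _ ((R m).edges_ne_nil hac)
    exact hdisj m n hmn e he (h ▸ he)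
  refine ⟨Set.range R, Set.infinite_range_of_injective hinj, ?_, ?_⟩
  · rintro _ ⟨m, rfl⟩ _ ⟨n, rfl⟩ h
    exact hdisj m n (fun h' => h (congrArg R h'))
  · rintro _ ⟨m, rfl⟩ _ ⟨n, rfl⟩ h
    exact hoc m n (fun h' => h (congrArg R h'))
end
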